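/- arXiv:1902.00013 — 4 statements merged into one kernel-verified Lean document; each statement's English description precedes it below -/
import Mathlib

section
/- Let 𝒢 be an arbitrary ultragraph and R a unital commutative ring with no zero divisors. Then the ultragraph Leavitt path algebra L_R(𝒢) is semiprime, i.e., for every ideal I of L_R(𝒢), I² = 0 implies I = 0. -/
universe u v w

/-- An ultragraph `𝒢 = (G⁰, 𝒢¹, r, s)`: a set of vertices `V`, a set of edges `E`,
a source map `s : E → V` and a range map `r : E → P(V) ∖ {∅}`. -/
structure Ultragraph (V : Type u) (E : Type v) where
  s : E → V
  r : E → Set V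
  r_nonempty : ∀ e, (r e).Nonempty

namespace Ultragraph

variable {V : Type u} {E : Type v}

/-- The collection `𝒢⁰` of generalized vertices: the smallest collection of subsets of `V`
containing all singletons and all ranges, closed under finite unions and intersections
(it contains the empty set). -/
inductive IsG0 (G : Ultragraph V E) : Set V → Prop
  | empty : IsG0 G ∅
  | singleton (v : V) : IsG0 G {v}
  | range (e : E) : IsG0 G (G.r e)
  | union {A B : Set V} : IsG0 G A → IsG0 G B → IsG0 G (A ∪ B)
  | inter {A B : Set V} : IsG0 G A → IsG0 G B → IsG0 G (A ∩ B)

/-- `𝒢⁰` as a type. -/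
def G0 (G : Ultragraph V E) : Type u := {A : Set V // G.IsG0 A}

def vtx (G : Ultragraph V E) (v : V) : G.G0 := ⟨{v}, IsG0.singleton v⟩

def rng (G : Ultragraph V E) (e : E) : G.G0 := ⟨G.r e, IsG0.range e⟩

def emptyG0 (G : Ultragraph V E) : G.G0 := ⟨∅, IsG0.empty⟩

def interG0 (G : Ultragraph V E) (A B : G.G0) : G.G0 := ⟨A.1 ∩ B.1, A.2.inter B.2⟩

def unionG0 (G : Ultragraph V E) (A B : G.G0) : G.G0 := ⟨A.1 ∪ B.1, A.2.union B.2⟩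

/-- Generators of the ultragraph Leavitt path algebra: edges `s_e`, ghost edges `s_e*`,
and projections `p_A` for `A ∈ 𝒢⁰`. -/
inductive LGen (G : Ultragraph V E) : Type max u v
  | edge (e : E) : LGen G
  | ghost (e : E) : LGen G
  | proj (A : G.G0) : LGen G

/-- The defining relations of the ultragraph Leavitt path algebra, as a relation on the
free `R`-algebra on the generators. -/
inductive LeavittRel (R : Type w) [CommRing R] (G : Ultragraph V E) :
    FreeAlgebra R (LGen G) → FreeAlgebra R (LGen G) → Prop
  | p_empty :
      LeavittRel R G (FreeAlgebra.ι R (LGen.proj G.emptyG0)) 0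
  | p_mul (A B : G.G0) :
      LeavittRel R G (FreeAlgebra.ι R (LGen.proj A) * FreeAlgebra.ι R (LGen.proj B))
        (FreeAlgebra.ι R (LGen.proj (G.interG0 A B)))
  | p_union (A B : G.G0) :
      LeavittRel R G (FreeAlgebra.ι R (LGen.proj (G.unionG0 A B)))
        (FreeAlgebra.ι R (LGen.proj A) + FreeAlgebra.ι R (LGen.proj B)
          - FreeAlgebra.ι R (LGen.proj (G.interG0 A B)))
  | src_edge (e : E) :
      LeavittRel R G
        (FreeAlgebra.ι R (LGen.proj (G.vtx (G.s e))) * FreeAlgebra.ι R (LGen.edge e))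
        (FreeAlgebra.ι R (LGen.edge e))
  | edge_rng (e : E) :
      LeavittRel R G
        (FreeAlgebra.ι R (LGen.edge e) * FreeAlgebra.ι R (LGen.proj (G.rng e)))
        (FreeAlgebra.ι R (LGen.edge e))
  | rng_ghost (e : E) :
      LeavittRel R G
        (FreeAlgebra.ι R (LGen.proj (G.rng e)) * FreeAlgebra.ι R (LGen.ghost e))
        (FreeAlgebra.ι R (LGen.ghost e))
  | ghost_src (e : E) :
      LeavittRel R G
        (FreeAlgebra.ι R (LGen.ghost e) * FreeAlgebra.ι R (LGen.proj (G.vtx (G.s e))))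
        (FreeAlgebra.ι R (LGen.ghost e))
  | ghost_edge_ne {e f : E} (h : e ≠ f) :
      LeavittRel R G (FreeAlgebra.ι R (LGen.ghost e) * FreeAlgebra.ι R (LGen.edge f)) 0
  | ghost_edge (e : E) :
      LeavittRel R G (FreeAlgebra.ι R (LGen.ghost e) * FreeAlgebra.ι R (LGen.edge e))
        (FreeAlgebra.ι R (LGen.proj (G.rng e)))
  | ck (v : V) (hfin : {e : E | G.s e = v}.Finite) (hne : {e : E | G.s e = v}.Nonempty) :
      LeavittRel R G (FreeAlgebra.ι R (LGen.proj (G.vtx v)))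
        (∑ e ∈ hfin.toFinset, FreeAlgebra.ι R (LGen.edge e) * FreeAlgebra.ι R (LGen.ghost e))

/-- The ultragraph Leavitt path algebra `L_R(𝒢)`. -/
def LeavittAlgebra (R : Type w) [CommRing R] (G : Ultragraph V E) : Type max u v w :=
  RingQuot (LeavittRel R G)

instance (R : Type w) [CommRing R] (G : Ultragraph V E) : Ring (LeavittAlgebra R G) :=
  inferInstanceAs (Ring (RingQuot (LeavittRel R G)))

instance (R : Type w) [CommRing R] (G : Ultragraph V E) : Algebra R (LeavittAlgebra R G) :=
  inferInstanceAs (Algebra R (RingQuot (LeavittRel R G)))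

/-- The projection `p_A ∈ L_R(𝒢)`, for `A ∈ 𝒢⁰`. -/
def Pg (G : Ultragraph V E) (R : Type w) [CommRing R] (A : G.G0) : LeavittAlgebra R G :=
  RingQuot.mkAlgHom R (LeavittRel R G) (FreeAlgebra.ι R (LGen.proj A))

/-- The element `s_e ∈ L_R(𝒢)`. -/
def Se (G : Ultragraph V E) (R : Type w) [CommRing R] (e : E) : LeavittAlgebra R G :=
  RingQuot.mkAlgHom R (LeavittRel R G) (FreeAlgebra.ι R (LGen.edge e))

/-- The element `s_e* ∈ L_R(𝒢)`. -/
def St (G : Ultragraph V E) (R : Type w) [CommRing R] (e : E) : LeavittAlgebra R G :=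
  RingQuot.mkAlgHom R (LeavittRel R G) (FreeAlgebra.ι R (LGen.ghost e))

/-- For a finite path `c = c₁ ⋯ c_k`, the element `s_c = s_{c₁} ⋯ s_{c_k}`
(the empty product for the empty list). -/
def Sp (G : Ultragraph V E) (R : Type w) [CommRing R] (c : List E) : LeavittAlgebra R G :=
  (c.map (G.Se R)).prod

/-- A (finite, nonempty) path in the ultragraph. -/
def IsPath (G : Ultragraph V E) (c : List E) : Prop :=
  c ≠ [] ∧ c.Chain' (fun e f => G.s f ∈ G.r e)

/-- A closed path: a path with `s(c₁) ∈ r(c_k)`. -/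
def IsClosedPath (G : Ultragraph V E) (c : List E) : Prop :=
  ∃ h : G.IsPath c, G.s (c.head h.1) ∈ G.r (c.getLast h.1)

/-- A cycle: a closed path whose edges have pairwise distinct sources. -/
def IsCycle (G : Ultragraph V E) (c : List E) : Prop :=
  G.IsClosedPath c ∧ c.Pairwise (fun e f => G.s e ≠ G.s f)

/-- A sink: a vertex emitting no edges. -/
def IsSink (G : Ultragraph V E) (v : V) : Prop := ∀ e, G.s e ≠ v

/-- An exit for a closed path `c`: an edge `f` with `s(f) ∈ r(c_i)` and `f ≠ c_{i+1}`
(indices cyclic), or a sink in some `r(c_i)`. -/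
def HasExit (G : Ultragraph V E) (c : List E) : Prop :=
  (∃ (f : E) (i : Fin c.length), G.s f ∈ G.r (c.get i) ∧
      f ≠ c.get ⟨(i.1 + 1) % c.length, Nat.mod_lt _ i.pos⟩) ∨
  (∃ (w : V) (i : Fin c.length), G.IsSink w ∧ w ∈ G.r (c.get i))

/-- Condition (L): every closed path has an exit. -/
def ConditionL (G : Ultragraph V E) : Prop :=
  ∀ c : List E, G.IsClosedPath c → G.HasExit c

/-- The range `r(c)` of a finite path `c` (the range of its last edge). -/
def pathRange (G : Ultragraph V E) (c : List E) : Set V :=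
  (c.getLast?.map G.r).getD ∅

theorem isG0_pathRange (G : Ultragraph V E) (c : List E) : G.IsG0 (G.pathRange c) := by
  unfold pathRange
  cases c.getLast? with
  | none => exact IsG0.empty
  | some e => exact IsG0.range e

/-- The range of a path, as an element of `𝒢⁰`. -/
def pathRng (G : Ultragraph V E) (c : List E) : G.G0 :=
  ⟨G.pathRange c, G.isG0_pathRange c⟩

end Ultragraph
namespace Ultragraph

open scoped Classical

variable {V : Type u} {E : Type v}

/-- A `𝒢`-algebraic branching system on a set `X`. -/
structure BranchingSystem (G : Ultragraph V E) (X : Type*) where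
  Re : E → Set X
  D : G.G0 → Set X
  disj : ∀ ⦃e f : E⦄, e ≠ f → Re e ∩ Re f = ∅
  D_empty : D G.emptyG0 = ∅
  D_inter : ∀ A B : G.G0, D A ∩ D B = D (G.interG0 A B)
  D_union : ∀ A B : G.G0, D A ∪ D B = D (G.unionG0 A B)
  Re_subset : ∀ e : E, Re e ⊆ D (G.vtx (G.s e))
  D_vtx : ∀ v : V, {e : E | G.s e = v}.Finite → {e : E | G.s e = v}.Nonempty →
    D (G.vtx v) = ⋃ e ∈ {e : E | G.s e = v}, Re e
  fe : ∀ e : E, ↥(D (G.rng e)) ≃ ↥(Re e)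

namespace BranchingSystem

variable {G : Ultragraph V E} {X : Type*}

/-- The extension of `f_e : D_{r(e)} → R_e` to a function `X → X` (identity elsewhere). -/
noncomputable def tot (B : BranchingSystem G X) (e : E) : X → X := fun x =>
  if h : x ∈ B.D (G.rng e) then (B.fe e ⟨x, h⟩ : X) else x

/-- For a path `c = c₁ ⋯ c_k`, the composite `f_c = f_{c₁} ∘ ⋯ ∘ f_{c_k}` (extended). -/
noncomputable def pathMap (B : BranchingSystem G X) (c : List E) : X → X :=
  c.foldr (fun e g => B.tot e ∘ g) id

end BranchingSystem

/-- `π : L_R(𝒢) → Hom_R(M)`, with `M` the module of all functions `X → R`, is the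
representation induced by the branching system `B` if it satisfies the defining formulas
`π(s_e)(φ) = (φ ∘ f_e⁻¹)·1_{R_e}`, `π(s_e*)(φ) = (φ ∘ f_e)·1_{D_{r(e)}}`,
`π(p_A)(φ) = 1_{D_A}·φ`. -/
def IsInducedRep (G : Ultragraph V E) (R : Type w) [CommRing R] {X : Type*}
    (B : BranchingSystem G X)
    (π : LeavittAlgebra R G →ₐ[R] Module.End R (X → R)) : Prop :=
  (∀ (e : E) (φ : X → R) (x : X),
      π (G.Se R e) φ x = if h : x ∈ B.Re e then φ ((B.fe e).symm ⟨x, h⟩ : X) else 0) ∧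
  (∀ (e : E) (φ : X → R) (x : X),
      π (G.St R e) φ x = if h : x ∈ B.D (G.rng e) then φ ((B.fe e ⟨x, h⟩ : X)) else 0) ∧
  (∀ (A : G.G0) (φ : X → R) (x : X),
      π (G.Pg R A) φ x = if x ∈ B.D A then φ x else 0)

/-- The analogue of `IsInducedRep` for the module of finitely supported functions `X →₀ R`. -/
def IsInducedRepF (G : Ultragraph V E) (R : Type w) [CommRing R] {X : Type*}
    (B : BranchingSystem G X)
    (π : LeavittAlgebra R G →ₐ[R] Module.End R (X →₀ R)) : Prop :=
  (∀ (e : E) (φ : X →₀ R) (x : X),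
      π (G.Se R e) φ x = if h : x ∈ B.Re e then φ ((B.fe e).symm ⟨x, h⟩ : X) else 0) ∧
  (∀ (e : E) (φ : X →₀ R) (x : X),
      π (G.St R e) φ x = if h : x ∈ B.D (G.rng e) then φ ((B.fe e ⟨x, h⟩ : X)) else 0) ∧
  (∀ (A : G.G0) (φ : X →₀ R) (x : X),
      π (G.Pg R A) φ x = if x ∈ B.D A then φ x else 0)

section Representations

variable (G : Ultragraph V E) (R : Type w) [CommRing R]
variable {N : Type*} [AddCommGroup N] [Module R N]

/-- `S` is a basis of the submodule `W`: it is contained in `W`, linearly independent,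
and spans `W`. -/
def IsBasisOf (S : Set N) (W : Submodule R N) : Prop :=
  S ⊆ (W : Set N) ∧ LinearIndependent R ((↑) : S → N) ∧ Submodule.span R S = W

/-- The submodule `N_v = π(p_v)(N)`. -/
def NvSub (π : LeavittAlgebra R G →ₐ[R] Module.End R N) (v : V) : Submodule R N :=
  LinearMap.range (π (G.Pg R (G.vtx v)))

/-- The submodule `N_{r(e)} = π(p_{r(e)})(N)`. -/
def NreSub (π : LeavittAlgebra R G →ₐ[R] Module.End R N) (e : E) : Submodule R N :=
  LinearMap.range (π (G.Pg R (G.rng e)))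

/-- The submodule `N_A = π(p_A)(N)`. -/
def NASub (π : LeavittAlgebra R G →ₐ[R] Module.End R N) (A : G.G0) : Submodule R N :=
  LinearMap.range (π (G.Pg R A))

/-- The submodule `N_e = π(s_e s_e*)(N)`. -/
def NeSub (π : LeavittAlgebra R G →ₐ[R] Module.End R N) (e : E) : Submodule R N :=
  LinearMap.range (π (G.Se R e * G.St R e))

/-- The data exhibiting a representation `π : L_R(𝒢) → Hom_R(N)` as permutative:
bases `B` of `N`, `B_v` of `N_v`, `B_{r(e)}` of `N_{r(e)}`, `B_e` of `N_e` with
`B_v, B_{r(e)} ⊆ B`, `B_v ⊆ B_{r(e)}` for `v ∈ r(e)`, `B_e ⊆ B_{s(e)}`, and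
`π(s_e)(B_{r(e)}) = B_e`. -/
structure PermutativeData (π : LeavittAlgebra R G →ₐ[R] Module.End R N) where
  B : Set N
  Bv : V → Set N
  Br : E → Set N
  Be : E → Set N
  hB : LinearIndependent R ((↑) : B → N) ∧ Submodule.span R B = ⊤
  hBv : ∀ v : V, IsBasisOf R (Bv v) (NvSub G R π v)
  hBr : ∀ e : E, IsBasisOf R (Br e) (NreSub G R π e)
  hBe : ∀ e : E, IsBasisOf R (Be e) (NeSub G R π e)
  hBvB : ∀ v : V, Bv v ⊆ B
  hBrB : ∀ e : E, Br e ⊆ B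
  hBvBr : ∀ (e : E) (v : V), v ∈ G.r e → Bv v ⊆ Br e
  hBeBv : ∀ e : E, Be e ⊆ Bv (G.s e)
  hmap : ∀ e : E, (π (G.Se R e)) '' (Br e) = Be e

/-- A representation is permutative if such data exists. -/
def IsPermutative (π : LeavittAlgebra R G →ₐ[R] Module.End R N) : Prop :=
  Nonempty (PermutativeData G R π)

end Representations

/-- A description of `A ∈ 𝒢⁰` as `(⋂_{e∈X₁} r(e)) ∪ ⋯ ∪ (⋂_{e∈Xₙ} r(e)) ∪ F`
with each `Xᵢ` a nonempty finite set of edges and `F` a finite set of vertices. -/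
structure G0Desc (G : Ultragraph V E) (A : Set V) where
  n : ℕ
  Xs : Fin n → Finset E
  hXs : ∀ i, (Xs i).Nonempty
  F : Finset V
  eq : A = (⋃ i, ⋂ e ∈ (Xs i : Set E), G.r e) ∪ (F : Set V)

/-- The set `B_A` associated to a description of `A ∈ 𝒢⁰` and permutative data. -/
def BAset {G : Ultragraph V E} (R : Type w) [CommRing R]
    {N : Type*} [AddCommGroup N] [Module R N]
    {π : LeavittAlgebra R G →ₐ[R] Module.End R N}
    (P : PermutativeData G R π) {A : Set V} (d : G0Desc G A) : Set N :=
  (⋃ i, ⋂ e ∈ (d.Xs i : Set E), P.Br e) ∪ ⋃ v ∈ (d.F : Set V), P.Bv v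

end Ultragraph
namespace Ultragraph

variable {V : Type u} {E : Type v}

/-! ### Extreme vertices and the iterated construction `𝔾ₙ`, `Xₙ`, `Yₙ`, `Iₙ`

A sub-ultragraph is recorded as a pair `(W, Ed)` of a set of remaining vertices and a set
of remaining edges; ranges are intersected with `W`. -/

/-- `e` is the extreme edge of the extreme vertex `A = r(e) ∩ W` of the sub-ultragraph
`(W, Ed)`: `r(e)` meets no other range and no source. -/
def IsExtremeRangeEdge (G : Ultragraph V E) (W : Set V) (Ed : Set E) (e : E) : Prop :=
  e ∈ Ed ∧ (∀ f ∈ Ed, f ≠ e → (G.r e ∩ W) ∩ (G.r f ∩ W) = ∅) ∧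
    (∀ f ∈ Ed, G.s f ∉ G.r e ∩ W)

/-- `e` is the extreme edge of the extreme vertex `A = {s(e)}` of the sub-ultragraph
`(W, Ed)`: `s(e)` is the source of no other edge and lies in no range. -/
def IsExtremeSourceEdge (G : Ultragraph V E) (W : Set V) (Ed : Set E) (e : E) : Prop :=
  e ∈ Ed ∧ G.s e ∈ W ∧ (∀ f ∈ Ed, f ≠ e → G.s f ≠ G.s e) ∧
    (∀ f ∈ Ed, G.s e ∉ G.r f ∩ W)

/-- The set of extreme vertices of the sub-ultragraph `(W, Ed)`. -/
def ExtremeVertSets (G : Ultragraph V E) (W : Set V) (Ed : Set E) : Set (Set V) :=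
  {A | (∃ e, G.IsExtremeRangeEdge W Ed e ∧ A = G.r e ∩ W) ∨
    (∃ e, G.IsExtremeSourceEdge W Ed e ∧ A = {G.s e})}

/-- The set of extreme edges of the sub-ultragraph `(W, Ed)`. -/
def ExtremeEdges (G : Ultragraph V E) (W : Set V) (Ed : Set E) : Set E :=
  {e | G.IsExtremeRangeEdge W Ed e ∨ G.IsExtremeSourceEdge W Ed e}

/-- The isolated vertices of the sub-ultragraph `(W, Ed)`: vertices of `W` lying in no
range and being no source. -/
def Isolated (G : Ultragraph V E) (W : Set V) (Ed : Set E) : Set V :=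
  {v ∈ W | (∀ e ∈ Ed, v ∉ G.r e) ∧ (∀ e ∈ Ed, G.s e ≠ v)}

/-- `stage G n` is the sub-ultragraph `𝔾ₙ`; `stage G 0 = 𝔾₀` is obtained from `𝒢` by
removing the isolated vertices, and `𝔾ₙ₊₁` is obtained from `𝔾ₙ` by removing the extreme
vertices `X̄ₙ₊₁`, the extreme edges `Yₙ₊₁`, and then the resulting isolated vertices
`Iₙ₊₁`. -/
def stage (G : Ultragraph V E) : ℕ → Set V × Set E
  | 0 => ({w | w ∈ (⋃ e : E, G.r e) ∪ Set.range G.s}, Set.univ)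
  | n + 1 =>
      let p := stage G n
      let W' := p.1 \ ⋃₀ G.ExtremeVertSets p.1 p.2
      let Ed' := p.2 \ G.ExtremeEdges p.1 p.2
      (W' \ G.Isolated W' Ed', Ed')

/-- `XStep G n` is the set `Xₙ₊₁` of extreme vertices of `𝔾ₙ`. -/
def XStep (G : Ultragraph V E) (n : ℕ) : Set (Set V) :=
  G.ExtremeVertSets (G.stage n).1 (G.stage n).2

/-- `XbarStep G n` is `X̄ₙ₊₁ = ⋃_{A ∈ Xₙ₊₁} A`. -/
def XbarStep (G : Ultragraph V E) (n : ℕ) : Set V := ⋃₀ G.XStep n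

/-- `IStep G n` is the set `Iₙ₊₁` of isolated vertices of the ultragraph obtained from
`𝔾ₙ` by removing `X̄ₙ₊₁` and `Yₙ₊₁`. -/
def IStep (G : Ultragraph V E) (n : ℕ) : Set V :=
  G.Isolated ((G.stage n).1 \ G.XbarStep n)
    ((G.stage n).2 \ G.ExtremeEdges (G.stage n).1 (G.stage n).2)

end Ultragraph


set_option linter.unusedVariables false
set_option linter.unusedSimpArgs false
namespace Ultragraph
section SemiprimeAux
variable {V : Type u} {E : Type v} (G : Ultragraph V E) (R : Type w) [CommRing R]

/-- The quotient map. -/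
def mkL : FreeAlgebra R (LGen G) →ₐ[R] LeavittAlgebra R G :=
  RingQuot.mkAlgHom R (LeavittRel R G)

theorem mkL_surj : Function.Surjective (mkL G R) := RingQuot.mkAlgHom_surjective R _

theorem mkL_rel {x y : FreeAlgebra R (LGen G)} (h : LeavittRel R G x y) :
    mkL G R x = mkL G R y := RingQuot.mkAlgHom_rel R h

theorem mkL_proj (A : G.G0) : mkL G R (FreeAlgebra.ι R (LGen.proj A)) = G.Pg R A := rfl
theorem mkL_edge (e : E) : mkL G R (FreeAlgebra.ι R (LGen.edge e)) = G.Se R e := rfl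
theorem mkL_ghost (e : E) : mkL G R (FreeAlgebra.ι R (LGen.ghost e)) = G.St R e := rfl

theorem P_empty : G.Pg R G.emptyG0 = 0 := by
  have := mkL_rel G R LeavittRel.p_empty
  rwa [map_zero] at this

theorem P_mul (A B : G.G0) : G.Pg R A * G.Pg R B = G.Pg R (G.interG0 A B) := by
  have := mkL_rel G R (LeavittRel.p_mul A B)
  rwa [map_mul] at this

theorem P_union (A B : G.G0) :
    G.Pg R (G.unionG0 A B) = G.Pg R A + G.Pg R B - G.Pg R (G.interG0 A B) := by
  have := mkL_rel G R (LeavittRel.p_union A B)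
  rwa [map_sub, map_add] at this

theorem P_S (e : E) : G.Pg R (G.vtx (G.s e)) * G.Se R e = G.Se R e := by
  have := mkL_rel G R (LeavittRel.src_edge e)
  rwa [map_mul] at this

theorem S_P (e : E) : G.Se R e * G.Pg R (G.rng e) = G.Se R e := by
  have := mkL_rel G R (LeavittRel.edge_rng e)
  rwa [map_mul] at this

theorem P_T (e : E) : G.Pg R (G.rng e) * G.St R e = G.St R e := by
  have := mkL_rel G R (LeavittRel.rng_ghost e)
  rwa [map_mul] at this

theorem T_P (e : E) : G.St R e * G.Pg R (G.vtx (G.s e)) = G.St R e := by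
  have := mkL_rel G R (LeavittRel.ghost_src e)
  rwa [map_mul] at this

theorem T_S_ne {e f : E} (h : e ≠ f) : G.St R e * G.Se R f = 0 := by
  have := mkL_rel G R (LeavittRel.ghost_edge_ne h)
  rwa [map_mul, map_zero] at this

theorem T_S (e : E) : G.St R e * G.Se R e = G.Pg R (G.rng e) := by
  have := mkL_rel G R (LeavittRel.ghost_edge e)
  rwa [map_mul] at this

theorem P_ck (v : V) (hfin : {e : E | G.s e = v}.Finite) (hne : {e : E | G.s e = v}.Nonempty) :
    G.Pg R (G.vtx v) = ∑ e ∈ hfin.toFinset, G.Se R e * G.St R e := by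
  have := mkL_rel G R (LeavittRel.ck v hfin hne)
  rw [map_sum] at this
  simpa only [map_mul, mkL_proj, mkL_edge, mkL_ghost] using this

/-- Universal property. -/
theorem exists_lift {B : Type*} [Ring B] [Algebra R B] (g : LGen G → B)
    (h : ∀ x y, LeavittRel R G x y → FreeAlgebra.lift R g x = FreeAlgebra.lift R g y) :
    ∃ φ : LeavittAlgebra R G →ₐ[R] B, (∀ A, φ (G.Pg R A) = g (.proj A)) ∧
      (∀ e, φ (G.Se R e) = g (.edge e)) ∧ (∀ e, φ (G.St R e) = g (.ghost e)) := by
  let φ : LeavittAlgebra R G →ₐ[R] B := RingQuot.liftAlgHom R ⟨FreeAlgebra.lift R g, h⟩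
  have key : ∀ x, φ (mkL G R x) = FreeAlgebra.lift R g x := fun x =>
    RingQuot.liftAlgHom_mkAlgHom_apply R _ h x
  refine ⟨φ, fun A => ?_, fun e => ?_, fun e => ?_⟩
  · rw [← mkL_proj, key, FreeAlgebra.lift_ι_apply]
  · rw [← mkL_edge, key, FreeAlgebra.lift_ι_apply]
  · rw [← mkL_ghost, key, FreeAlgebra.lift_ι_apply]

/-- The augmentation. -/
theorem exists_aug : ∃ φ : LeavittAlgebra R G →ₐ[R] R, (∀ A, φ (G.Pg R A) = 0) ∧
      (∀ e, φ (G.Se R e) = 0) ∧ (∀ e, φ (G.St R e) = 0) := by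
  refine exists_lift G R (fun _ => (0 : R)) ?_
  intro x y h
  cases h <;> simp

/-- The grading coaction. -/
theorem exists_coact : ∃ δ : LeavittAlgebra R G →ₐ[R] AddMonoidAlgebra (LeavittAlgebra R G) ℤ,
      (∀ A, δ (G.Pg R A) = AddMonoidAlgebra.single 0 (G.Pg R A)) ∧
      (∀ e, δ (G.Se R e) = AddMonoidAlgebra.single 1 (G.Se R e)) ∧
      (∀ e, δ (G.St R e) = AddMonoidAlgebra.single (-1) (G.St R e)) := by
  refine exists_lift G R (fun g => match g with
    | .proj A => AddMonoidAlgebra.single 0 (G.Pg R A)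
    | .edge e => AddMonoidAlgebra.single 1 (G.Se R e)
    | .ghost e => AddMonoidAlgebra.single (-1) (G.St R e)) ?_
  intro x y h
  cases h with
  | p_empty =>
    simp only [map_mul, map_add, map_sub, map_zero, FreeAlgebra.lift_ι_apply, AddMonoidAlgebra.single_mul_single, 
      P_empty, AddMonoidAlgebra.single_zero]
  | p_mul A B =>
    simp only [map_mul, map_add, map_sub, map_zero, FreeAlgebra.lift_ι_apply, AddMonoidAlgebra.single_mul_single, 
      P_mul, add_zero]
  | p_union A B =>
    simp only [map_mul, map_add, map_sub, map_zero, FreeAlgebra.lift_ι_apply, AddMonoidAlgebra.single_mul_single, 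
      P_union, AddMonoidAlgebra.single_add, AddMonoidAlgebra.single_sub]
  | src_edge e =>
    simp only [map_mul, map_add, map_sub, map_zero, FreeAlgebra.lift_ι_apply, AddMonoidAlgebra.single_mul_single, 
      P_S, zero_add]
  | edge_rng e =>
    simp only [map_mul, map_add, map_sub, map_zero, FreeAlgebra.lift_ι_apply, AddMonoidAlgebra.single_mul_single, 
      S_P, add_zero]
  | rng_ghost e =>
    simp only [map_mul, map_add, map_sub, map_zero, FreeAlgebra.lift_ι_apply, AddMonoidAlgebra.single_mul_single, 
      P_T, zero_add]
  | ghost_src e =>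
    simp only [map_mul, map_add, map_sub, map_zero, FreeAlgebra.lift_ι_apply, AddMonoidAlgebra.single_mul_single, 
      T_P, add_zero]
  | ghost_edge_ne h =>
    simp only [map_mul, map_add, map_sub, map_zero, FreeAlgebra.lift_ι_apply, AddMonoidAlgebra.single_mul_single, 
      T_S_ne G R h, AddMonoidAlgebra.single_zero]
  | ghost_edge e =>
    simp only [map_mul, map_add, map_sub, map_zero, FreeAlgebra.lift_ι_apply, AddMonoidAlgebra.single_mul_single, 
      T_S, neg_add_cancel]
  | ck v hfin hne =>
    simp only [FreeAlgebra.lift_ι_apply, map_sum, map_mul, AddMonoidAlgebra.single_mul_single]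
    rw [P_ck G R v hfin hne]
    exact map_sum (AddMonoidAlgebra.singleAddHom (R := LeavittAlgebra R G) (0 : ℤ)) _ _

theorem exists_enc : ∃ (K : Type (max u v)) (_ : Nonempty K) (enc : E → V × K → V × K),
    (∀ e y, (enc e y).1 = G.s e) ∧
    (∀ e e' y y', y.1 ∈ G.r e → y'.1 ∈ G.r e' → enc e y = enc e' y' → e = e' ∧ y = y') ∧
    (∀ x e, G.s e = x.1 → ∃ e y, y.1 ∈ G.r e ∧ enc e y = x) := by
  classical
  let K := V ⊕ E ⊕ ℕ
  have hK : Infinite K := inferInstance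
  have hKK : Cardinal.aleph0 ≤ Cardinal.mk K := Cardinal.aleph0_le_mk K
  have h1 : ∀ v : V, (∃ e, G.s e = v) →
      Nonempty ({p : E × V × K // G.s p.1 = v ∧ p.2.1 ∈ G.r p.1} ≃ K) := by
    rintro v ⟨e, he⟩
    obtain ⟨w, hw⟩ := G.r_nonempty e
    have i1 : Nonempty (K ↪ {p : E × V × K // G.s p.1 = v ∧ p.2.1 ∈ G.r p.1}) :=
      ⟨⟨fun k => ⟨(e, w, k), he, hw⟩, fun a b h => by simpa using h⟩⟩
    have i2 : Nonempty ({p : E × V × K // G.s p.1 = v ∧ p.2.1 ∈ G.r p.1} ↪ K × K × K) :=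
      ⟨⟨fun p => (Sum.inr (Sum.inl p.1.1), Sum.inl p.1.2.1, p.1.2.2), by
        rintro ⟨⟨a, b, c⟩, h⟩ ⟨⟨a', b', c'⟩, h'⟩ hh
        simp only [Prod.mk.injEq] at hh
        have e1 := Sum.inl.inj (Sum.inr.inj hh.1)
        have e2 := Sum.inl.inj hh.2.1
        have e3 := hh.2.2
        subst e1 e2 e3
        rfl⟩⟩
    have i3 : Nonempty (K × K × K ≃ K) := by
      rw [← Cardinal.eq]
      simp [Cardinal.mul_eq_self hKK, -Cardinal.mk_sum]
    obtain ⟨i1⟩ := i1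
    obtain ⟨i2⟩ := i2
    obtain ⟨i3⟩ := i3
    obtain ⟨g, hg⟩ := Function.Embedding.schroeder_bernstein (i2.trans i3.toEmbedding).injective
      i1.injective
    exact ⟨Equiv.ofBijective g hg⟩
  have Θ := h1
  refine ⟨K, ⟨Sum.inr (Sum.inr 0)⟩, fun e y => (G.s e, if h : y.1 ∈ G.r e then
    (Θ (G.s e) ⟨e, rfl⟩).some ⟨(e, y), rfl, h⟩ else y.2), fun _ _ => rfl, ?_, ?_⟩
  · intro e e' y y' hy hy' h
    simp only [hy, hy', dif_pos, Prod.mk.injEq] at h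
    obtain ⟨h1, h2⟩ := h
    have : ∀ v (hv : G.s e = v), (Θ (G.s e) ⟨e, rfl⟩).some ⟨(e, y), rfl, hy⟩ =
      (Θ v ⟨e, hv⟩).some ⟨(e, y), hv, hy⟩ := by rintro _ rfl; rfl
    rw [this _ h1] at h2
    have := (Θ (G.s e') ⟨e, h1⟩).some.injective h2
    simpa using this
  · rintro ⟨v, k⟩ e he
    let p := (Θ v ⟨e, he⟩).some.symm k
    refine ⟨p.1.1, p.1.2, p.2.2, ?_⟩
    beta_reduce
    rw [dif_pos p.2.2]
    have h3 : ∀ v' (hv : v' = v), (Θ v' ⟨e, he.trans hv.symm⟩).some ⟨p.1, p.2.1.trans hv.symm, p.2.2⟩ = k := by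
      rintro _ rfl
      exact (Θ _ ⟨e, he⟩).some.apply_symm_apply k
    exact Prod.ext p.2.1 (h3 _ p.2.1)

open Classical in
theorem exists_rep : ∃ (K : Type (max u v)) (_ : Nonempty K)
    (φ : LeavittAlgebra R G →ₐ[R] Module.End R (V × K → R)),
    ∀ A f x, φ (G.Pg R A) f x = if x.1 ∈ A.1 then f x else 0 := by
  obtain ⟨K, hK, enc, h1, h2, h3⟩ := exists_enc G
  let S : E → Module.End R (V × K → R) := fun e =>
    { toFun := fun f x => if h : ∃ y : V × K, y.1 ∈ G.r e ∧ enc e y = x then f h.choose else 0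
      map_add' := by
        intro f g; ext x; simp only [Pi.add_apply]; split_ifs <;> simp
      map_smul' := by
        intro c f; ext x; simp only [Pi.smul_apply]; split_ifs <;> simp }
  let T : E → Module.End R (V × K → R) := fun e =>
    { toFun := fun f y => if y.1 ∈ G.r e then f (enc e y) else 0
      map_add' := by
        intro f g; ext x; simp only [Pi.add_apply]; split_ifs <;> simp
      map_smul' := by
        intro c f; ext x; simp only [Pi.smul_apply]; split_ifs <;> simp }
  let P : G.G0 → Module.End R (V × K → R) := fun A =>
    { toFun := fun f y => if y.1 ∈ A.1 then f y else 0
      map_add' := by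
        intro f g; ext x; simp only [Pi.add_apply]; split_ifs <;> simp
      map_smul' := by
        intro c f; ext x; simp only [Pi.smul_apply]; split_ifs <;> simp }
  have hP : ∀ A f x, P A f x = if x.1 ∈ A.1 then f x else 0 := fun _ _ _ => rfl
  have hT : ∀ e f y, T e f y = if y.1 ∈ G.r e then f (enc e y) else 0 := fun _ _ _ => rfl
  have hS1 : ∀ e f y, y.1 ∈ G.r e → S e f (enc e y) = f y := by
    intro e f y hy
    have h : ∃ y' : V × K, y'.1 ∈ G.r e ∧ enc e y' = enc e y := ⟨y, hy, rfl⟩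
    have : S e f (enc e y) = f h.choose := dif_pos h
    rw [this, (h2 _ _ _ _ h.choose_spec.1 hy h.choose_spec.2).2]
  have hS0 : ∀ e f x, (¬ ∃ y : V × K, y.1 ∈ G.r e ∧ enc e y = x) → S e f x = 0 := by
    intro e f x h
    exact dif_neg h
  have hv : ∀ v, (G.vtx v).1 = {v} := fun _ => rfl
  have hr : ∀ e, (G.rng e).1 = G.r e := fun _ => rfl
  have hi : ∀ A B, (G.interG0 A B).1 = A.1 ∩ B.1 := fun _ _ => rfl
  have hu : ∀ A B, (G.unionG0 A B).1 = A.1 ∪ B.1 := fun _ _ => rfl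
  have h0 : (G.emptyG0).1 = ∅ := rfl
  obtain ⟨φ, hφ, -, -⟩ := exists_lift G R (B := Module.End R (V × K → R)) (fun g => match g with
    | .proj A => P A
    | .edge e => S e
    | .ghost e => T e) (by
    intro x y h
    cases h with
    | p_empty => ext f x; simp [hP, h0]
    | p_mul A B =>
      ext f x
      simp only [map_mul, FreeAlgebra.lift_ι_apply, Module.End.mul_apply, hP, hi, Set.mem_inter_iff]
      by_cases a : x.1 ∈ A.1 <;> by_cases b : x.1 ∈ B.1 <;> simp [a, b]
    | p_union A B =>
      ext f x
      simp only [map_sub, map_add, FreeAlgebra.lift_ι_apply, LinearMap.sub_apply,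
        LinearMap.add_apply, Pi.sub_apply, Pi.add_apply, hP, hi, hu, Set.mem_inter_iff, Set.mem_union]
      by_cases a : x.1 ∈ A.1 <;> by_cases b : x.1 ∈ B.1 <;> simp [a, b]
    | src_edge e =>
      ext f x
      simp only [map_mul, FreeAlgebra.lift_ι_apply, Module.End.mul_apply, hP, hv, Set.mem_singleton_iff]
      split_ifs with h
      · rfl
      · rw [hS0]
        rintro ⟨y, hy, rfl⟩
        exact h (h1 _ _)
    | edge_rng e =>
      ext f x
      simp only [map_mul, FreeAlgebra.lift_ι_apply, Module.End.mul_apply]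
      by_cases h : ∃ y : V × K, y.1 ∈ G.r e ∧ enc e y = x
      · obtain ⟨y, hy, rfl⟩ := h
        rw [hS1 _ _ _ hy, hS1 _ _ _ hy, hP, hr, if_pos hy]
      · rw [hS0 _ _ _ h, hS0 _ _ _ h]
    | rng_ghost e =>
      ext f x
      simp only [map_mul, FreeAlgebra.lift_ι_apply, Module.End.mul_apply, hP, hT, hr]
      split_ifs <;> rfl
    | ghost_src e =>
      ext f x
      simp only [map_mul, FreeAlgebra.lift_ι_apply, Module.End.mul_apply, hP, hT, hv, h1]
      simp
    | ghost_edge_ne h =>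
      rename_i e f'
      ext f x
      simp only [map_mul, FreeAlgebra.lift_ι_apply, Module.End.mul_apply, hT]
      split_ifs with hx
      · rw [hS0]
        · simp
        · rintro ⟨y, hy, hh⟩
          exact h (h2 _ _ _ _ hy hx hh).1.symm
      · simp
    | ghost_edge e =>
      ext f x
      simp only [map_mul, FreeAlgebra.lift_ι_apply, Module.End.mul_apply, hT, hP, hr]
      split_ifs with hx
      · rw [hS1 _ _ _ hx]
      · rfl
    | ck v hfin hne =>
      ext f x
      simp only [map_mul, map_sum, FreeAlgebra.lift_ι_apply, Module.End.mul_apply, hP, hv,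
        Set.mem_singleton_iff, LinearMap.sum_apply, Finset.sum_apply]
      split_ifs with hx
      · obtain ⟨e, he⟩ := hne
        obtain ⟨e', y, hy, rfl⟩ := h3 x e (he.trans hx.symm)
        rw [Finset.sum_eq_single e']
        · rw [hS1 _ _ _ hy, hT, if_pos hy]
        · intro b hb hbe
          rw [hS0]
          rintro ⟨y', hy', hh⟩
          exact hbe (h2 _ _ _ _ hy' hy hh).1
        · intro hh
          exact absurd (hfin.mem_toFinset.2 ((h1 e' y).symm.trans hx)) hh
      · rw [Finset.sum_eq_zero]
        intro e he
        rw [hS0]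
        rintro ⟨y', hy', rfl⟩
        exact hx ((h1 _ _).trans (hfin.mem_toFinset.1 he)))
  exact ⟨K, hK, φ, fun A f x => by rw [hφ]; exact hP A f x⟩

theorem torsion_free (c : R) (A : G.G0) (hA : A.1.Nonempty) (h : c • G.Pg R A = 0) : c = 0 := by
  obtain ⟨K, ⟨k⟩, φ, hφ⟩ := exists_rep G R
  obtain ⟨v, hv⟩ := hA
  have := congrArg (fun z => φ z (fun _ => 1) (v, k)) h
  simpa [hφ, hv] using this

theorem P_sub {A B : G.G0} (h : A.1 ⊆ B.1) : G.Pg R A * G.Pg R B = G.Pg R A := by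
  rw [P_mul]
  exact congrArg _ (Subtype.ext (Set.inter_eq_left.2 h))

theorem P_comm (A B : G.G0) : G.Pg R A * G.Pg R B = G.Pg R B * G.Pg R A := by
  rw [P_mul, P_mul]
  exact congrArg _ (Subtype.ext (Set.inter_comm _ _))

theorem P_mem {A : G.G0} {v : V} (h : v ∈ A.1) :
    G.Pg R A * G.Pg R (G.vtx v) = G.Pg R (G.vtx v) := by
  rw [P_comm, P_sub]
  exact Set.singleton_subset_iff.2 h

theorem P_nmem {A : G.G0} {v : V} (h : v ∉ A.1) :
    G.Pg R A * G.Pg R (G.vtx v) = 0 := by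
  rw [P_mul, ← P_empty G R]
  exact congrArg _ (Subtype.ext (Set.inter_singleton_eq_empty.2 h))

theorem P_S_mem {A : G.G0} {e : E} (h : G.s e ∈ A.1) : G.Pg R A * G.Se R e = G.Se R e := by
  rw [← P_S, ← mul_assoc, P_mem G R h]

theorem P_S_nmem {A : G.G0} {e : E} (h : G.s e ∉ A.1) : G.Pg R A * G.Se R e = 0 := by
  rw [← P_S, ← mul_assoc, P_nmem G R h, zero_mul]

theorem T_P_mem {A : G.G0} {e : E} (h : G.s e ∈ A.1) : G.St R e * G.Pg R A = G.St R e := by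
  rw [← T_P, mul_assoc, P_comm, P_mem G R h]

theorem T_P_nmem {A : G.G0} {e : E} (h : G.s e ∉ A.1) : G.St R e * G.Pg R A = 0 := by
  rw [← T_P, mul_assoc, P_comm, P_nmem G R h, mul_zero]

/-- span of the projections -/
def Pspan : Submodule R (LeavittAlgebra R G) := Submodule.span R (Set.range (G.Pg R))

/-- value of a formal combination -/
def lval (c : R) (l : List (R × G.G0)) : LeavittAlgebra R G :=
  c • 1 + (l.map fun x => x.1 • G.Pg R x.2).sum

theorem lval_cons (c : R) (x : R × G.G0) (l) :
    lval G R c (x :: l) = lval G R c l + x.1 • G.Pg R x.2 := by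
  simp only [lval, List.map_cons, List.sum_cons]; abel

theorem lval_add (c d : R) (l) : lval G R (c + d) l = lval G R c l + d • 1 := by
  simp only [lval, add_smul]; abel

theorem lattice_aux (l : List (R × G.G0)) : ∀ (c : R) (B C : G.G0),
    (∀ v ∈ B.1, v ∉ C.1 → lval G R c l * G.Pg R (G.vtx v) = 0) →
    lval G R c l * (G.Pg R B * (1 - G.Pg R C)) = 0 := by
  induction l with
  | nil =>
    intro c B C h
    by_cases hBC : B.1 ⊆ C.1
    · rw [mul_sub, P_sub G R hBC]; simp
    · obtain ⟨v, hv, hv'⟩ := Set.not_subset.1 hBC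
      have h1 := h v hv hv'
      simp only [lval, List.map_nil, List.sum_nil, add_zero, smul_mul_assoc, one_mul] at h1 ⊢
      rw [torsion_free G R c (G.vtx v) ⟨v, Set.mem_singleton v⟩ h1, zero_smul]
  | cons x l ih =>
    intro c B C h
    obtain ⟨d, A⟩ := x
    have hA : lval G R c ((d, A) :: l) * G.Pg R A = lval G R (c + d) l * G.Pg R A := by
      rw [lval_cons, lval_add, add_mul, add_mul, smul_mul_assoc, smul_mul_assoc, one_mul,
        P_sub G R subset_rfl]
    have hA' : lval G R c ((d, A) :: l) * (1 - G.Pg R A) = lval G R c l * (1 - G.Pg R A) := by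
      rw [lval_cons, add_mul, smul_mul_assoc, mul_sub (G.Pg R A), mul_one,
        P_sub G R subset_rfl, sub_self, smul_zero, add_zero]
    have e1 : G.Pg R A * (G.Pg R B * (1 - G.Pg R C)) =
        G.Pg R A * (G.Pg R (G.interG0 B A) * (1 - G.Pg R C)) := by
      rw [← P_mul, P_comm G R B A, ← mul_assoc, ← mul_assoc, ← mul_assoc, P_sub G R subset_rfl]
    have e2 : (1 - G.Pg R A) * (G.Pg R B * (1 - G.Pg R C)) =
        G.Pg R B * (1 - G.Pg R (G.unionG0 A C)) := by
      rw [P_union, ← P_mul]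
      have : (1 - G.Pg R A) * G.Pg R B = G.Pg R B * (1 - G.Pg R A) := by
        rw [sub_mul, mul_sub, P_comm, one_mul, mul_one]
      rw [← mul_assoc, this, mul_assoc]
      noncomm_ring
    have e3 : (1 - G.Pg R A) * (G.Pg R B * (1 - G.Pg R (G.unionG0 A C))) =
        G.Pg R B * (1 - G.Pg R (G.unionG0 A C)) := by
      rw [← e2, ← mul_assoc, ← mul_assoc, ← mul_assoc]
      congr 2
      rw [sub_mul, one_mul, mul_sub (G.Pg R A), mul_one, P_sub G R subset_rfl, sub_self, sub_zero]
    have i1 := ih (c + d) (G.interG0 B A) C (by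
      rintro v ⟨hv, hvA⟩ hvC
      rw [← P_mem G R hvA, ← mul_assoc, ← hA, mul_assoc, P_mem G R hvA, h v hv hvC])
    have i2 := ih c B (G.unionG0 A C) (by
      intro v hv hvC
      have hvA : v ∉ A.1 := fun h => hvC (Or.inl h)
      have : (1 - G.Pg R A) * G.Pg R (G.vtx v) = G.Pg R (G.vtx v) := by
        rw [sub_mul, P_nmem G R hvA, one_mul, sub_zero]
      rw [← this, ← mul_assoc, ← hA', mul_assoc, this, h v hv (fun h => hvC (Or.inr h))])
    have e4 : G.Pg R A * (G.Pg R (G.interG0 B A) * (1 - G.Pg R C)) =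
        G.Pg R (G.interG0 B A) * (1 - G.Pg R C) := by
      rw [← mul_assoc, P_comm, P_sub G R Set.inter_subset_right]
    have e5 : G.Pg R B * (1 - G.Pg R C) = G.Pg R A * (G.Pg R B * (1 - G.Pg R C)) +
        (1 - G.Pg R A) * (G.Pg R B * (1 - G.Pg R C)) := by
      rw [← add_mul, add_sub_cancel, one_mul]
    rw [e5, mul_add, e1, e2, ← mul_assoc, hA, mul_assoc, e4, i1, ← e3, ← mul_assoc, hA', mul_assoc,
      e3, i2, add_zero]

theorem lattice_zero {a : LeavittAlgebra R G} (ha : a ∈ Pspan G R)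
    (h : ∀ v, a * G.Pg R (G.vtx v) = 0) : a = 0 := by
  have h1 : ∃ l, a = lval G R 0 l := by
    refine Submodule.span_induction (p := fun a _ => ∃ l, a = lval G R 0 l) ?_ ?_ ?_ ?_ ha
    · rintro _ ⟨A, rfl⟩
      exact ⟨[(1, A)], by simp [lval]⟩
    · exact ⟨[], by simp [lval]⟩
    · rintro _ _ - - ⟨l, rfl⟩ ⟨l', rfl⟩
      exact ⟨l ++ l', by simp [lval]⟩
    · rintro c _ - ⟨l, rfl⟩
      refine ⟨l.map fun x => (c * x.1, x.2), ?_⟩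
      simp only [lval, zero_smul, zero_add, List.smul_sum, List.map_map]
      congr 2
      funext x
      simp [mul_smul]
  have h2 : ∃ B, a * G.Pg R B = a := by
    refine Submodule.span_induction (p := fun a _ => ∃ B, a * G.Pg R B = a) ?_ ?_ ?_ ?_ ha
    · rintro _ ⟨A, rfl⟩
      exact ⟨A, P_sub G R subset_rfl⟩
    · exact ⟨G.emptyG0, by simp⟩
    · rintro x y - - ⟨l, hl⟩ ⟨l', hl'⟩
      refine ⟨G.unionG0 l l', ?_⟩
      rw [add_mul, ← hl, ← hl', mul_assoc, mul_assoc, P_sub G R Set.subset_union_left,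
        P_sub G R Set.subset_union_right]
    · rintro c x - ⟨l, hl⟩
      exact ⟨l, by rw [smul_mul_assoc, hl]⟩
  obtain ⟨l, rfl⟩ := h1
  obtain ⟨B, hB⟩ := h2
  have := lattice_aux G R l 0 B G.emptyG0 (fun v _ _ => h v)
  rwa [P_empty, sub_zero, mul_one, hB] at this

theorem exists_fun {b : LeavittAlgebra R G} (hb : b ∈ Pspan G R) :
    ∃ f : V → R, ∀ v, b * G.Pg R (G.vtx v) = f v • G.Pg R (G.vtx v) := by
  classical
  refine Submodule.span_induction (p := fun b _ => ∃ f : V → R, ∀ v,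
    b * G.Pg R (G.vtx v) = f v • G.Pg R (G.vtx v)) ?_ ?_ ?_ ?_ hb
  · rintro _ ⟨A, rfl⟩
    refine ⟨fun v => if v ∈ A.1 then 1 else 0, fun v => ?_⟩
    by_cases h : v ∈ A.1
    · rw [P_mem G R h]; simp [h]
    · rw [P_nmem G R h]; simp [h]
  · exact ⟨0, by simp⟩
  · rintro x y - - ⟨f, hf⟩ ⟨g, hg⟩
    exact ⟨f + g, fun v => by rw [add_mul, hf, hg, Pi.add_apply, add_smul]⟩
  · rintro c x - ⟨f, hf⟩
    exact ⟨c • f, fun v => by rw [smul_mul_assoc, hf, Pi.smul_apply, smul_assoc]⟩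

theorem Pspan_mul {b : LeavittAlgebra R G} (hb : b ∈ Pspan G R) (A : G.G0) :
    b * G.Pg R A ∈ Pspan G R := by
  refine Submodule.span_induction (p := fun b _ => b * G.Pg R A ∈ Pspan G R) ?_ ?_ ?_ ?_ hb
  · rintro _ ⟨B, rfl⟩
    rw [P_mul]
    exact Submodule.subset_span ⟨_, rfl⟩
  · simp
  · intro x y _ _ hx hy
    rw [add_mul]; exact add_mem hx hy
  · intro c x _ hx
    rw [smul_mul_assoc]; exact Submodule.smul_mem _ _ hx

theorem key [NoZeroDivisors R] {a b : LeavittAlgebra R G} (hb : b ∈ Pspan G R) (f : V → R)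
    (hf : ∀ v, b * G.Pg R (G.vtx v) = f v • G.Pg R (G.vtx v)) (S : Finset E)
    (ha : a = b - ∑ e ∈ S, f (G.s e) • (G.Se R e * G.St R e))
    (Q : ∀ y, a * y * a = 0) : a = 0 := by
  classical
  have sv : ∀ e v, (G.Se R e * G.St R e) * G.Pg R (G.vtx v) =
      if G.s e = v then G.Se R e * G.St R e else 0 := by
    intro e v
    split_ifs with h
    · rw [mul_assoc, T_P_mem]; exact h
    · rw [mul_assoc, T_P_nmem, mul_zero]; exact h
  have hav : ∀ v, a * G.Pg R (G.vtx v) = f v • (G.Pg R (G.vtx v) -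
      ∑ e ∈ S with G.s e = v, G.Se R e * G.St R e) := by
    intro v
    rw [ha, sub_mul, hf, smul_sub, Finset.sum_mul, Finset.sum_filter, Finset.smul_sum]
    congr 1
    refine Finset.sum_congr rfl fun e _ => ?_
    rw [smul_mul_assoc, sv]
    split_ifs with h
    · rw [h]
    · simp
  have h1 : ∀ v, a * G.Pg R (G.vtx v) = 0 := by
    intro v
    by_cases hex : ∃ e, G.s e = v ∧ e ∉ S
    · obtain ⟨e, rfl, heS⟩ := hex
      have h2 : a * G.Se R e = f (G.s e) • G.Se R e := by
        rw [ha, sub_mul, ← P_S, ← mul_assoc, hf, smul_mul_assoc, P_S, Finset.sum_mul,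
          Finset.sum_eq_zero, sub_zero]
        intro g hg
        have : g ≠ e := fun h => heS (h ▸ hg)
        rw [smul_mul_assoc, mul_assoc, T_S_ne G R this, mul_zero, smul_zero]
      have h3 : G.St R e * (a * (G.Se R e * G.St R e) * a) * G.Se R e =
          (f (G.s e) * f (G.s e)) • G.Pg R (G.rng e) := by
        have : G.St R e * (a * (G.Se R e * G.St R e) * a) * G.Se R e =
          (G.St R e * (a * G.Se R e)) * (G.St R e * (a * G.Se R e)) := by noncomm_ring
        rw [this, h2, mul_smul_comm, T_S, smul_mul_smul_comm, P_sub G R subset_rfl]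
      rw [Q, mul_zero, zero_mul] at h3
      have h4 := torsion_free G R _ _ (G.r_nonempty e) h3.symm
      rw [hav, mul_self_eq_zero.1 h4, zero_smul]
    · push Not at hex
      by_cases hne : {e : E | G.s e = v}.Nonempty
      · have hfin : {e : E | G.s e = v}.Finite := S.finite_toSet.subset fun e he => hex e he
        have : hfin.toFinset = S.filter (fun e => G.s e = v) := by
          ext e
          simp only [Set.Finite.mem_toFinset, Set.mem_setOf_eq, Finset.mem_filter]
          exact ⟨fun h => ⟨hex e h, h⟩, fun h => h.2⟩
        rw [hav, P_ck G R v hfin hne, this, sub_self, smul_zero]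
      · have h2 := hav v
        rw [Finset.sum_eq_zero, sub_zero] at h2
        · have h3 : (a * G.Pg R (G.vtx v) * a) * G.Pg R (G.vtx v) =
            (f v * f v) • G.Pg R (G.vtx v) := by
            rw [mul_assoc, h2, smul_mul_smul_comm, P_sub G R subset_rfl]
          rw [Q, zero_mul] at h3
          have h4 := torsion_free G R _ (G.vtx v) ⟨v, Set.mem_singleton v⟩ h3.symm
          rw [h2, mul_self_eq_zero.1 h4, zero_smul]
        · intro e he
          exact absurd ⟨e, (Finset.mem_filter.1 he).2⟩ hne
  refine lattice_zero G R ?_ h1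
  have h5 : ∑ v ∈ S.image G.s, a * G.Pg R (G.vtx v) = 0 := Finset.sum_eq_zero fun v _ => h1 v
  have h6 : ∑ v ∈ S.image G.s, a * G.Pg R (G.vtx v) =
      ∑ v ∈ S.image G.s, b * G.Pg R (G.vtx v) - (b - a) := by
    have : b - a = ∑ e ∈ S, f (G.s e) • (G.Se R e * G.St R e) := by rw [ha]; abel
    rw [this]
    conv_lhs => rw [ha]
    simp_rw [sub_mul, Finset.sum_sub_distrib, Finset.sum_mul]
    rw [Finset.sum_comm]
    congr 1
    refine Finset.sum_congr rfl fun e he => ?_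
    simp_rw [smul_mul_assoc, sv]
    rw [Finset.sum_eq_single (G.s e)]
    · simp
    · intro v _ hv
      rw [if_neg hv.symm, smul_zero]
    · intro h
      exact absurd (Finset.mem_image_of_mem _ he) h
  have h7 : a = b - ∑ v ∈ S.image G.s, b * G.Pg R (G.vtx v) := by
    rw [h5] at h6
    have h8 := sub_eq_zero.1 h6.symm
    rw [h8]; abel
  rw [h7]
  exact sub_mem hb (sum_mem fun v _ => Pspan_mul G R hb _)

/-- filtration of the degree zero part -/
def F : ℕ → Submodule R (LeavittAlgebra R G)
  | 0 => Pspan G R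
  | n + 1 => Pspan G R ⊔
      Submodule.span R {z | ∃ e f, ∃ x ∈ F n, z = G.Se R e * x * G.St R f}

theorem Pspan_le_F : ∀ n, Pspan G R ≤ F G R n
  | 0 => le_rfl
  | _ + 1 => le_sup_left

theorem P_mem_F (n : ℕ) (A : G.G0) : G.Pg R A ∈ F G R n :=
  Pspan_le_F G R n (Submodule.subset_span ⟨A, rfl⟩)

theorem STF {n : ℕ} {x : LeavittAlgebra R G} (hx : x ∈ F G R n) (e f : E) :
    G.Se R e * x * G.St R f ∈ F G R (n + 1) :=
  Submodule.mem_sup_right (Submodule.subset_span ⟨e, f, x, hx, rfl⟩)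

theorem F_ind {n : ℕ} {p : LeavittAlgebra R G → Prop} (hP : ∀ A, p (G.Pg R A))
    (hST : ∀ e f, ∀ x ∈ F G R n, p (G.Se R e * x * G.St R f)) (h0 : p 0)
    (hadd : ∀ x y, p x → p y → p (x + y)) (hsmul : ∀ (c : R) x, p x → p (c • x))
    {x : LeavittAlgebra R G} (hx : x ∈ F G R (n + 1)) : p x := by
  obtain ⟨b, hb, c, hc, rfl⟩ := Submodule.mem_sup.1 hx
  refine hadd _ _ ?_ ?_
  · refine Submodule.span_induction (p := fun x _ => p x) ?_ h0
      (fun x y _ _ => hadd x y) (fun c x _ => hsmul c x) hb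
    rintro _ ⟨A, rfl⟩; exact hP A
  · refine Submodule.span_induction (p := fun x _ => p x) ?_ h0
      (fun x y _ _ => hadd x y) (fun c x _ => hsmul c x) hc
    rintro _ ⟨e, f, x, hx, rfl⟩; exact hST e f x hx

theorem mul_Pspan {b : LeavittAlgebra R G} (hb : b ∈ Pspan G R) (A : G.G0) :
    G.Pg R A * b ∈ Pspan G R := by
  refine Submodule.span_induction (p := fun b _ => G.Pg R A * b ∈ Pspan G R) ?_ ?_ ?_ ?_ hb
  · rintro _ ⟨B, rfl⟩
    rw [P_mul]
    exact Submodule.subset_span ⟨_, rfl⟩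
  · simp
  · intro x y _ _ hx hy
    rw [mul_add]; exact add_mem hx hy
  · intro c x _ hx
    rw [mul_smul_comm]; exact Submodule.smul_mem _ _ hx

theorem P_F {n : ℕ} {x : LeavittAlgebra R G} (hx : x ∈ F G R n) (A : G.G0) :
    G.Pg R A * x ∈ F G R n := by
  cases n with
  | zero => exact mul_Pspan G R hx A
  | succ n =>
    refine F_ind G R (p := fun x => G.Pg R A * x ∈ F G R (n + 1)) ?_ ?_ ?_ ?_ ?_ hx
    · intro B; rw [P_mul]; exact P_mem_F G R _ _
    · intro e f x hx
      rw [← mul_assoc, ← mul_assoc]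
      by_cases h : G.s e ∈ A.1
      · rw [P_S_mem G R h]; exact STF G R hx e f
      · rw [P_S_nmem G R h]; simp
    · simp
    · intro x y hx hy
      rw [mul_add]; exact add_mem hx hy
    · intro c x hx
      rw [mul_smul_comm]; exact Submodule.smul_mem _ _ hx

theorem F_P {n : ℕ} {x : LeavittAlgebra R G} (hx : x ∈ F G R n) (A : G.G0) :
    x * G.Pg R A ∈ F G R n := by
  cases n with
  | zero => exact Pspan_mul G R hx A
  | succ n =>
    refine F_ind G R (p := fun x => x * G.Pg R A ∈ F G R (n + 1)) ?_ ?_ ?_ ?_ ?_ hx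
    · intro B; rw [P_mul]; exact P_mem_F G R _ _
    · intro e f x hx
      rw [mul_assoc]
      by_cases h : G.s f ∈ A.1
      · rw [T_P_mem G R h]; exact STF G R hx e f
      · rw [T_P_nmem G R h]; simp
    · simp
    · intro x y hx hy
      rw [add_mul]; exact add_mem hx hy
    · intro c x hx
      rw [smul_mul_assoc]; exact Submodule.smul_mem _ _ hx

theorem T_F_S {n : ℕ} {x : LeavittAlgebra R G} (hx : x ∈ F G R (n + 1)) (e f : E) :
    G.St R e * x * G.Se R f ∈ F G R n := by
  refine F_ind G R (p := fun x => G.St R e * x * G.Se R f ∈ F G R n) ?_ ?_ ?_ ?_ ?_ hx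
  · intro A
    by_cases h : G.s e ∈ A.1
    · rw [T_P_mem G R h]
      by_cases hef : e = f
      · subst hef; rw [T_S]; exact P_mem_F G R _ _
      · rw [T_S_ne G R hef]; exact zero_mem _
    · rw [T_P_nmem G R h]; simp
  · intro e' f' x hx
    have h1 : G.St R e * (G.Se R e' * x * G.St R f') * G.Se R f =
      (G.St R e * G.Se R e') * x * (G.St R f' * G.Se R f) := by noncomm_ring
    rw [h1]
    by_cases he : e = e'
    · by_cases hf : f' = f
      · subst he hf
        rw [T_S, T_S]; exact F_P G R (P_F G R hx _) _
      · rw [T_S_ne G R hf]; simp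
    · rw [T_S_ne G R he]; simp
  · simp
  · intro x y hx hy
    rw [mul_add, add_mul]; exact add_mem hx hy
  · intro c x hx
    rw [mul_smul_comm, smul_mul_assoc]; exact Submodule.smul_mem _ _ hx

/-- sum of range projections -/
def qq (S : Finset E) : LeavittAlgebra R G := ∑ e ∈ S, G.Se R e * G.St R e

theorem qq_S {S : Finset E} {e : E} (he : e ∈ S) : qq G R S * G.Se R e = G.Se R e := by
  classical
  rw [qq, Finset.sum_mul, Finset.sum_eq_single e]
  · rw [mul_assoc, T_S, S_P]
  · intro f _ hf
    rw [mul_assoc, T_S_ne G R hf, mul_zero]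
  · intro h; exact absurd he h

theorem T_qq {S : Finset E} {e : E} (he : e ∈ S) : G.St R e * qq G R S = G.St R e := by
  classical
  rw [qq, Finset.mul_sum, Finset.sum_eq_single e]
  · rw [← mul_assoc, T_S, P_T]
  · intro f _ hf
    rw [← mul_assoc, T_S_ne G R hf.symm, zero_mul]
  · intro h; exact absurd he h

theorem Q_stable {a : LeavittAlgebra R G} (Q : ∀ y, a * y * a = 0) (b c : LeavittAlgebra R G) :
    ∀ y, (b * a * c) * y * (b * a * c) = 0 := by
  intro y
  have : (b * a * c) * y * (b * a * c) = b * (a * (c * y * b) * a) * c := by noncomm_ring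
  rw [this, Q, mul_zero, zero_mul]

theorem F_main [NoZeroDivisors R] (n : ℕ) : ∀ a ∈ F G R n, (∀ y, a * y * a = 0) → a = 0 := by
  classical
  induction n with
  | zero =>
    intro a ha Q
    obtain ⟨f, hf⟩ := exists_fun G R ha
    exact key G R ha f hf ∅ (by simp) Q
  | succ n ih =>
    intro a ha Q
    have hTS : ∀ e f, G.St R e * a * G.Se R f = 0 := fun e f =>
      ih _ (T_F_S G R ha e f) (Q_stable G R Q _ _)
    obtain ⟨b, hb, c, hc, hbc⟩ := Submodule.mem_sup.1 ha
    have hS : ∃ S0 : Finset E, ∀ S, S0 ⊆ S → qq G R S * c * qq G R S = c := by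
      refine Submodule.span_induction (p := fun c _ => ∃ S0 : Finset E, ∀ S, S0 ⊆ S →
        qq G R S * c * qq G R S = c) ?_ ?_ ?_ ?_ hc
      · rintro _ ⟨e, f, x, hx, rfl⟩
        refine ⟨{e, f}, fun S hS => ?_⟩
        have h1 : qq G R S * (G.Se R e * x * G.St R f) * qq G R S =
          (qq G R S * G.Se R e) * x * (G.St R f * qq G R S) := by noncomm_ring
        rw [h1, qq_S G R (hS (by simp)), T_qq G R (hS (by simp))]
      · exact ⟨∅, by simp⟩
      · rintro x y - - ⟨S1, h1⟩ ⟨S2, h2⟩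
        refine ⟨S1 ∪ S2, fun S hS => ?_⟩
        rw [mul_add, add_mul, h1 S (Finset.union_subset_left hS),
          h2 S (Finset.union_subset_right hS)]
      · rintro r x - ⟨S1, h1⟩
        refine ⟨S1, fun S hS => ?_⟩
        rw [mul_smul_comm, smul_mul_assoc, h1 S hS]
    obtain ⟨S, hS⟩ := hS
    have hS := hS S subset_rfl
    have hq : qq G R S * a * qq G R S = 0 := by
      rw [qq, Finset.sum_mul, Finset.sum_mul]
      refine Finset.sum_eq_zero fun e _ => ?_
      rw [Finset.mul_sum]
      refine Finset.sum_eq_zero fun f _ => ?_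
      have : G.Se R e * G.St R e * a * (G.Se R f * G.St R f) =
        G.Se R e * (G.St R e * a * G.Se R f) * G.St R f := by noncomm_ring
      rw [this, hTS, mul_zero, zero_mul]
    obtain ⟨f, hf⟩ := exists_fun G R hb
    have hbS : ∀ e, b * G.Se R e = f (G.s e) • G.Se R e := by
      intro e
      rw [← P_S, ← mul_assoc, hf, smul_mul_assoc]
    have hqb : qq G R S * b * qq G R S = ∑ e ∈ S, f (G.s e) • (G.Se R e * G.St R e) := by
      conv_lhs => rw [mul_assoc]; arg 2; arg 2; rw [qq]
      rw [Finset.mul_sum, Finset.mul_sum]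
      refine Finset.sum_congr rfl fun e he => ?_
      rw [← mul_assoc b, hbS, smul_mul_assoc, mul_smul_comm, ← mul_assoc, qq_S G R he]
    refine key G R hb f hf S ?_ Q
    rw [← hbc, mul_add, add_mul, hS, hqb] at hq
    rw [← hbc, sub_eq_add_neg]
    congr 1
    exact eq_neg_of_add_eq_zero_right hq

/-- monomials -/
inductive IsMon : ℕ → ℕ → LeavittAlgebra R G → Prop
  | zero (i j : ℕ) : IsMon i j 0
  | P (A : G.G0) : IsMon 0 0 (G.Pg R A)
  | S {i j : ℕ} {x : LeavittAlgebra R G} (e : E) (h : IsMon i j x) :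
      IsMon (i + 1) j (G.Se R e * x)
  | T {i j : ℕ} {x : LeavittAlgebra R G} (e : E) (h : IsMon i j x) :
      IsMon i (j + 1) (x * G.St R e)

theorem IsMon.P_mul {i j : ℕ} {x : LeavittAlgebra R G} (h : IsMon G R i j x) (A : G.G0) :
    IsMon G R i j (G.Pg R A * x) := by
  induction h with
  | zero i j => rw [mul_zero]; exact IsMon.zero i j
  | P B => rw [Ultragraph.P_mul]; exact IsMon.P _
  | S e h ih =>
    rw [← mul_assoc]
    by_cases he : G.s e ∈ A.1
    · rw [P_S_mem G R he]; exact IsMon.S e h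
    · rw [P_S_nmem G R he, zero_mul]; exact IsMon.zero _ _
  | T e h ih => rw [← mul_assoc]; exact IsMon.T e ih

theorem IsMon.T_mul {i j : ℕ} {x : LeavittAlgebra R G} (h : IsMon G R i j x) (e : E) :
    ∃ i' j', IsMon G R i' j' (G.St R e * x) := by
  induction h with
  | zero i j => rw [mul_zero]; exact ⟨0, 0, IsMon.zero _ _⟩
  | P B =>
    by_cases he : G.s e ∈ B.1
    · rw [T_P_mem G R he, ← P_T]; exact ⟨_, _, IsMon.T e (IsMon.P _)⟩
    · rw [T_P_nmem G R he]; exact ⟨0, 0, IsMon.zero _ _⟩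
  | S f h ih =>
    rw [← mul_assoc]
    by_cases he : e = f
    · subst he; rw [T_S]; exact ⟨_, _, h.P_mul G R _⟩
    · rw [T_S_ne G R he, zero_mul]; exact ⟨0, 0, IsMon.zero _ _⟩
  | T f h ih =>
    obtain ⟨i', j', ih⟩ := ih
    rw [← mul_assoc]; exact ⟨_, _, IsMon.T f ih⟩

theorem IsMon.exS {n j : ℕ} {x : LeavittAlgebra R G} (h : IsMon G R n j x) :
    ∀ i, n = i + 1 → x = 0 ∨ ∃ e y, x = G.Se R e * y ∧ IsMon G R i j y := by
  induction h with
  | zero i j => intro _ _; exact Or.inl rfl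
  | P B => intro _ h; omega
  | S f h ih =>
    rintro i hi
    obtain rfl : _ = i := Nat.succ.inj hi
    exact Or.inr ⟨_, _, rfl, h⟩
  | T f h ih =>
    intro i hi
    rcases ih i hi with rfl | ⟨e, y, rfl, hy⟩
    · left; rw [zero_mul]
    · exact Or.inr ⟨e, _, mul_assoc _ _ _, IsMon.T f hy⟩

theorem IsMon.exT {i n : ℕ} {x : LeavittAlgebra R G} (h : IsMon G R i n x) :
    ∀ j, n = j + 1 → x = 0 ∨ ∃ e y, x = y * G.St R e ∧ IsMon G R i j y := by
  induction h with
  | zero i j => intro _ _; exact Or.inl rfl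
  | P B => intro _ h; omega
  | T f h ih =>
    rintro i hi
    obtain rfl : _ = i := Nat.succ.inj hi
    exact Or.inr ⟨_, _, rfl, h⟩
  | S f h ih =>
    intro i hi
    rcases ih i hi with rfl | ⟨e, y, rfl, hy⟩
    · left; rw [mul_zero]
    · exact Or.inr ⟨e, _, (mul_assoc _ _ _).symm, IsMon.S f hy⟩

theorem F_mono : Monotone (F G R) := by
  refine monotone_nat_of_le_succ fun n => ?_
  induction n with
  | zero => exact Pspan_le_F G R 1
  | succ n ih =>
    intro x hx
    refine F_ind G R (p := fun x => x ∈ F G R (n + 1 + 1)) ?_ ?_ ?_ ?_ ?_ hx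
    · intro A; exact P_mem_F G R _ _
    · intro e f x hx; exact STF G R (ih hx) e f
    · exact zero_mem _
    · intro x y; exact add_mem
    · intro c x; exact Submodule.smul_mem _ _

theorem IsMon.mem_F (i : ℕ) : ∀ {x : LeavittAlgebra R G}, IsMon G R i i x → x ∈ F G R i := by
  induction i with
  | zero =>
    intro x h
    cases h with
    | zero => exact zero_mem _
    | P A => exact P_mem_F G R _ _
  | succ i ih =>
    intro x h
    rcases h.exS G R i rfl with rfl | ⟨e, y, rfl, hy⟩
    · exact zero_mem _
    rcases hy.exT G R i rfl with rfl | ⟨f, z, rfl, hz⟩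
    · rw [mul_zero]; exact zero_mem _
    rw [← mul_assoc]
    exact STF G R (ih hz) e f

/-- homogeneous parts -/
def DD (n : ℤ) : Submodule R (LeavittAlgebra R G) :=
  Submodule.span R ({x | ∃ i j : ℕ, (i : ℤ) - j = n ∧ IsMon G R i j x} ∪ {x | n = 0 ∧ x = 1})

theorem one_mem_DD : (1 : LeavittAlgebra R G) ∈ DD G R 0 :=
  Submodule.subset_span (Or.inr ⟨rfl, rfl⟩)

theorem IsMon.mem_DD {i j : ℕ} {x : LeavittAlgebra R G} (h : IsMon G R i j x) :
    x ∈ DD G R ((i : ℤ) - j) :=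
  Submodule.subset_span (Or.inl ⟨i, j, rfl, h⟩)

theorem span_top (x : LeavittAlgebra R G) : x ∈ ⨆ n, DD G R n := by
  obtain ⟨z, rfl⟩ := mkL_surj G R x
  have hm : ∀ {i j : ℕ} {x : LeavittAlgebra R G}, IsMon G R i j x → x ∈ ⨆ n, DD G R n :=
    fun h => Submodule.mem_iSup_of_mem _ (h.mem_DD G R)
  have h1 : ∀ (g : LeavittAlgebra R G), (∃ i j, IsMon G R i j g) →
      (∀ i j x, IsMon G R i j x → ∃ i' j', IsMon G R i' j' (g * x)) →
      ∀ u ∈ ⨆ n, DD G R n, g * u ∈ ⨆ n, DD G R n := by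
    intro g hg hg' u hu
    refine Submodule.iSup_induction (DD G R) (motive := fun u => g * u ∈ ⨆ n, DD G R n) hu ?_ ?_ ?_
    · intro n u hu
      refine Submodule.span_induction (p := fun u _ => g * u ∈ ⨆ n, DD G R n) ?_ ?_ ?_ ?_ hu
      · rintro x (⟨i, j, -, hx⟩ | ⟨-, rfl⟩)
        · obtain ⟨_, _, h⟩ := hg' _ _ _ hx
          exact hm h
        · obtain ⟨_, _, h⟩ := hg
          rw [mul_one]; exact hm h
      · simp
      · intro x y _ _ hx hy
        rw [mul_add]; exact add_mem hx hy
      · intro c x _ hx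
        rw [mul_smul_comm]; exact Submodule.smul_mem _ _ hx
    · simp
    · intro x y hx hy
      rw [mul_add]; exact add_mem hx hy
  have h2 : ∀ u ∈ ⨆ n, DD G R n, mkL G R z * u ∈ ⨆ n, DD G R n := by
    induction z using FreeAlgebra.induction with
    | grade0 r =>
      intro u hu
      rw [AlgHom.commutes, ← Algebra.smul_def]; exact Submodule.smul_mem _ _ hu
    | grade1 g =>
      cases g with
      | proj A =>
        rw [mkL_proj]
        exact h1 _ ⟨_, _, IsMon.P A⟩ fun i j x h => ⟨_, _, h.P_mul G R A⟩
      | edge e =>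
        rw [mkL_edge]
        refine h1 _ ⟨1, 0, ?_⟩ fun i j x h => ⟨_, _, h.S e⟩
        rw [← S_P]; exact IsMon.S e (IsMon.P _)
      | ghost e =>
        rw [mkL_ghost]
        refine h1 _ ⟨0, 1, ?_⟩ fun i j x h => h.T_mul G R e
        rw [← P_T]; exact IsMon.T e (IsMon.P _)
    | mul a b ha hb =>
      intro u hu
      rw [map_mul, mul_assoc]; exact ha _ (hb _ hu)
    | add a b ha hb =>
      intro u hu
      rw [map_add, add_mul]; exact add_mem (ha _ hu) (hb _ hu)
  have := h2 1 (Submodule.mem_iSup_of_mem _ (one_mem_DD G R))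
  rwa [mul_one] at this

theorem hom_ind {p : LeavittAlgebra R G → Prop} (h : ∀ n, ∀ x ∈ DD G R n, p x)
    (hadd : ∀ x y, p x → p y → p (x + y)) (x : LeavittAlgebra R G) : p x :=
  Submodule.iSup_induction (DD G R) (motive := p) (span_top G R x) h (h 0 0 (zero_mem _)) hadd

theorem F_aug {φ : LeavittAlgebra R G →ₐ[R] R} (hP : ∀ A, φ (G.Pg R A) = 0)
    (hS : ∀ e, φ (G.Se R e) = 0) {n : ℕ} {x : LeavittAlgebra R G} (hx : x ∈ F G R n) :
    φ x = 0 := by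
  refine F_ind G R (n := n) (p := fun x => φ x = 0) hP ?_ (map_zero _) ?_ ?_
    (F_mono G R (Nat.le_succ n) hx)
  · intro e f x _
    rw [map_mul, map_mul, hS, zero_mul, zero_mul]
  · intro x y hx hy
    rw [map_add, hx, hy, add_zero]
  · intro c x hx
    rw [map_smul, hx, smul_zero]

theorem DD_zero_form {a : LeavittAlgebra R G} (ha : a ∈ DD G R 0) :
    ∃ (c : R) (N : ℕ), ∃ b ∈ F G R N, a = c • 1 + b := by
  refine Submodule.span_induction (p := fun a _ => ∃ (c : R) (N : ℕ), ∃ b ∈ F G R N,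
    a = c • 1 + b) ?_ ?_ ?_ ?_ ha
  · rintro x (⟨i, j, hij, hx⟩ | ⟨-, rfl⟩)
    · obtain rfl : i = j := by omega
      exact ⟨0, i, x, hx.mem_F G R i, by simp⟩
    · exact ⟨1, 0, 0, zero_mem _, by simp⟩
  · exact ⟨0, 0, 0, zero_mem _, by simp⟩
  · rintro x y - - ⟨c, N, b, hb, rfl⟩ ⟨c', N', b', hb', rfl⟩
    refine ⟨c + c', max N N', b + b', add_mem (F_mono G R (le_max_left _ _) hb)
      (F_mono G R (le_max_right _ _) hb'), ?_⟩
    rw [add_smul]; abel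
  · rintro r x - ⟨c, N, b, hb, rfl⟩
    exact ⟨r * c, N, r • b, Submodule.smul_mem _ _ hb, by rw [smul_add, mul_smul]⟩

theorem hom_zero [NoZeroDivisors R] {a : LeavittAlgebra R G} (ha : a ∈ DD G R 0)
    (Q : ∀ y, a * y * a = 0) : a = 0 := by
  obtain ⟨c, N, b, hb, rfl⟩ := DD_zero_form G R ha
  obtain ⟨φ, hP, hS, -⟩ := exists_aug G R
  have h1 : φ (c • 1 + b) = c := by
    rw [map_add, F_aug G R hP hS hb, map_smul, map_one, add_zero, smul_eq_mul, mul_one]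
  have h2 := congrArg φ (Q 1)
  rw [mul_one, map_mul, h1, map_zero] at h2
  have hc := mul_self_eq_zero.1 h2
  subst hc
  rw [zero_smul, zero_add] at Q ⊢
  exact F_main G R N b hb Q

theorem DD_pos {k : ℕ} {a : LeavittAlgebra R G} (ha : a ∈ DD G R ((k : ℤ) + 1)) :
    (∀ e, G.St R e * a ∈ DD G R k) ∧ ∃ S0 : Finset E, ∀ S, S0 ⊆ S → qq G R S * a = a := by
  classical
  refine Submodule.span_induction (p := fun a _ => (∀ e, G.St R e * a ∈ DD G R k) ∧
    ∃ S0 : Finset E, ∀ S, S0 ⊆ S → qq G R S * a = a) ?_ ?_ ?_ ?_ ha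
  · rintro x (⟨i, j, hij, hx⟩ | ⟨h, -⟩)
    · obtain ⟨i, rfl⟩ : ∃ i', i = i' + 1 := ⟨i - 1, by omega⟩
      obtain rfl | ⟨e, y, rfl, hy⟩ := hx.exS G R i rfl
      · exact ⟨by simp, ∅, by simp⟩
      refine ⟨fun f => ?_, {e}, fun S hS => ?_⟩
      · rw [← mul_assoc]
        by_cases hf : f = e
        · subst hf
          rw [T_S]
          have := (hy.P_mul G R (G.rng f)).mem_DD G R
          have h2 : (i : ℤ) - j = k := by omega
          rwa [h2] at this
        · rw [T_S_ne G R hf, zero_mul]; exact zero_mem _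
      · rw [← mul_assoc, qq_S G R (hS (by simp))]
    · omega
  · exact ⟨by simp, ∅, by simp⟩
  · rintro x y - - ⟨hx, S1, h1⟩ ⟨hy, S2, h2⟩
    refine ⟨fun e => by rw [mul_add]; exact add_mem (hx e) (hy e), S1 ∪ S2, fun S hS => ?_⟩
    rw [mul_add, h1 S (Finset.union_subset_left hS), h2 S (Finset.union_subset_right hS)]
  · rintro r x - ⟨hx, S1, h1⟩
    refine ⟨fun e => by rw [mul_smul_comm]; exact Submodule.smul_mem _ _ (hx e), S1,
      fun S hS => ?_⟩
    rw [mul_smul_comm, h1 S hS]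

theorem IsMon.mul_P {i j : ℕ} {x : LeavittAlgebra R G} (h : IsMon G R i j x) (A : G.G0) :
    IsMon G R i j (x * G.Pg R A) := by
  induction h with
  | zero i j => rw [zero_mul]; exact IsMon.zero i j
  | P B => rw [Ultragraph.P_mul]; exact IsMon.P _
  | T e h ih =>
    rw [mul_assoc]
    by_cases he : G.s e ∈ A.1
    · rw [T_P_mem G R he]; exact IsMon.T e h
    · rw [T_P_nmem G R he, mul_zero]; exact IsMon.zero _ _
  | S e h ih => rw [mul_assoc]; exact IsMon.S e ih

theorem DD_neg {k : ℕ} {a : LeavittAlgebra R G} (ha : a ∈ DD G R (-((k : ℤ) + 1))) :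
    (∀ e, a * G.Se R e ∈ DD G R (-(k : ℤ))) ∧
      ∃ S0 : Finset E, ∀ S, S0 ⊆ S → a * qq G R S = a := by
  classical
  refine Submodule.span_induction (p := fun a _ => (∀ e, a * G.Se R e ∈ DD G R (-(k : ℤ))) ∧
    ∃ S0 : Finset E, ∀ S, S0 ⊆ S → a * qq G R S = a) ?_ ?_ ?_ ?_ ha
  · rintro x (⟨i, j, hij, hx⟩ | ⟨h, -⟩)
    · obtain ⟨j, rfl⟩ : ∃ j', j = j' + 1 := ⟨j - 1, by omega⟩
      obtain rfl | ⟨e, y, rfl, hy⟩ := hx.exT G R j rfl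
      · exact ⟨by simp, ∅, by simp⟩
      refine ⟨fun f => ?_, {e}, fun S hS => ?_⟩
      · rw [mul_assoc]
        by_cases hf : e = f
        · subst hf
          rw [T_S]
          have := (hy.mul_P G R (G.rng e)).mem_DD G R
          have h2 : (i : ℤ) - j = -k := by omega
          rwa [h2] at this
        · rw [T_S_ne G R hf, mul_zero]; exact zero_mem _
      · rw [mul_assoc, T_qq G R (hS (by simp))]
    · omega
  · exact ⟨by simp, ∅, by simp⟩
  · rintro x y - - ⟨hx, S1, h1⟩ ⟨hy, S2, h2⟩
    refine ⟨fun e => by rw [add_mul]; exact add_mem (hx e) (hy e), S1 ∪ S2, fun S hS => ?_⟩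
    rw [add_mul, h1 S (Finset.union_subset_left hS), h2 S (Finset.union_subset_right hS)]
  · rintro r x - ⟨hx, S1, h1⟩
    refine ⟨fun e => by rw [smul_mul_assoc]; exact Submodule.smul_mem _ _ (hx e), S1,
      fun S hS => ?_⟩
    rw [smul_mul_assoc, h1 S hS]

theorem hom_pos [NoZeroDivisors R] (k : ℕ) : ∀ a ∈ DD G R (k : ℤ),
    (∀ y, a * y * a = 0) → a = 0 := by
  induction k with
  | zero => intro a ha Q; exact hom_zero G R ha Q
  | succ k ih =>
    intro a ha Q
    rw [Nat.cast_succ] at ha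
    obtain ⟨h1, S, h2⟩ := DD_pos G R ha
    rw [← h2 S subset_rfl, qq, Finset.sum_mul]
    refine Finset.sum_eq_zero fun e _ => ?_
    have := Q_stable G R Q (G.St R e) 1
    rw [mul_one] at this
    rw [mul_assoc, ih _ (h1 e) this, mul_zero]

theorem hom_neg [NoZeroDivisors R] (k : ℕ) : ∀ a ∈ DD G R (-(k : ℤ)),
    (∀ y, a * y * a = 0) → a = 0 := by
  induction k with
  | zero => intro a ha Q; exact hom_zero G R (by simpa using ha) Q
  | succ k ih =>
    intro a ha Q
    rw [Nat.cast_succ] at ha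
    obtain ⟨h1, S, h2⟩ := DD_neg G R ha
    rw [← h2 S subset_rfl, qq, Finset.mul_sum]
    refine Finset.sum_eq_zero fun e _ => ?_
    have := Q_stable G R Q 1 (G.Se R e)
    rw [one_mul] at this
    rw [← mul_assoc, ih _ (h1 e) this, zero_mul]

theorem hom_all [NoZeroDivisors R] {n : ℤ} {a : LeavittAlgebra R G} (ha : a ∈ DD G R n)
    (Q : ∀ y, a * y * a = 0) : a = 0 := by
  obtain ⟨k, rfl | rfl⟩ := n.eq_nat_or_neg
  · exact hom_pos G R k a ha Q
  · exact hom_neg G R k a ha Q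

theorem top_mul {B : Type*} [Ring B] {f g : AddMonoidAlgebra B ℤ} {n m : ℤ}
    (hf : ∀ k, n < k → f.coeff k = 0) (hg : ∀ k, m < k → g.coeff k = 0) :
    (f * g).coeff (n + m) = f.coeff n * g.coeff m ∧ ∀ k, n + m < k → (f * g).coeff k = 0 := by
  classical
  have key0 : ∀ i ∈ f.coeff.support, i ≤ n := by
    intro i hi
    by_contra h
    exact Finsupp.mem_support_iff.1 hi (hf i (not_le.1 h))
  have key1 : ∀ i ∈ g.coeff.support, i ≤ m := by
    intro i hi
    by_contra h
    exact Finsupp.mem_support_iff.1 hi (hg i (not_le.1 h))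
  constructor
  · rw [AddMonoidAlgebra.coeff_mul, Finsupp.sum, Finset.sum_eq_single n]
    · rw [Finsupp.sum, Finset.sum_eq_single m]
      · rw [if_pos rfl]
      · intro j _ hj
        rw [if_neg (by omega)]
      · intro h
        rw [if_pos rfl, Finsupp.notMem_support_iff.1 h, mul_zero]
    · intro i hi hin
      refine Finset.sum_eq_zero fun j hj => if_neg ?_
      have := key0 i hi
      have := key1 j hj
      omega
    · intro h
      refine Finset.sum_eq_zero fun j hj => ?_
      dsimp only
      rw [Finsupp.notMem_support_iff.1 h, zero_mul, ite_self]
  · intro k hk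
    rw [AddMonoidAlgebra.coeff_mul]
    refine Finset.sum_eq_zero fun i hi => Finset.sum_eq_zero fun j hj => if_neg ?_
    have := key0 i hi
    have := key1 j hj
    omega

theorem semiprime_main [NoZeroDivisors R] {x : LeavittAlgebra R G}
    (Q : ∀ y, x * y * x = 0) : x = 0 := by
  classical
  obtain ⟨δ, hP, hS, hT⟩ := exists_coact G R
  have hmon : ∀ {i j : ℕ} {x : LeavittAlgebra R G}, IsMon G R i j x →
      δ x = AddMonoidAlgebra.single ((i : ℤ) - j) x := by
    intro i j x h
    induction h with
    | zero i j => rw [map_zero, AddMonoidAlgebra.single_zero]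
    | P A => exact hP A
    | S e h ih =>
      rw [map_mul, ih, hS, AddMonoidAlgebra.single_mul_single]
      congr 1; push_cast; ring
    | T e h ih =>
      rw [map_mul, ih, hT, AddMonoidAlgebra.single_mul_single]
      congr 1; push_cast; ring
  have hD : ∀ n, ∀ x ∈ DD G R n, δ x = AddMonoidAlgebra.single n x := by
    intro n x hx
    refine Submodule.span_induction (p := fun x _ => δ x = AddMonoidAlgebra.single n x)
      ?_ ?_ ?_ ?_ hx
    · rintro z (⟨i, j, hij, hz⟩ | ⟨rfl, rfl⟩)
      · rw [← hij]; exact hmon hz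
      · rw [map_one]; rfl
    · rw [map_zero, AddMonoidAlgebra.single_zero]
    · intro x y _ _ hx hy
      rw [map_add, hx, hy, AddMonoidAlgebra.single_add]
    · intro c x _ hx
      rw [map_smul, hx, AddMonoidAlgebra.smul_single]
  have hco : ∀ (x : LeavittAlgebra R G) n, (δ x).coeff n ∈ DD G R n := by
    intro x n
    refine hom_ind G R (p := fun x => (δ x).coeff n ∈ DD G R n) ?_ ?_ x
    · intro m x hx
      rw [hD m x hx, AddMonoidAlgebra.coeff_single, Finsupp.single_apply]
      split_ifs with h
      · rw [← h]; exact hx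
      · exact zero_mem _
    · intro x y hx hy
      rw [map_add, AddMonoidAlgebra.coeff_add]
      exact add_mem hx hy
  have hsum : ∀ x : LeavittAlgebra R G,
      Finsupp.liftAddHom (fun _ : ℤ => AddMonoidHom.id (LeavittAlgebra R G)) (δ x).coeff = x := by
    intro x
    refine hom_ind G R (p := fun x => Finsupp.liftAddHom
      (fun _ : ℤ => AddMonoidHom.id (LeavittAlgebra R G)) (δ x).coeff = x) ?_ ?_ x
    · intro m x hx
      rw [hD m x hx, AddMonoidAlgebra.coeff_single, Finsupp.liftAddHom_apply_single]
      rfl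
    · intro x y hx hy
      rw [map_add, AddMonoidAlgebra.coeff_add, map_add, hx, hy]
  by_contra hx
  have hne : (δ x).coeff.support.Nonempty := by
    rw [Finsupp.support_nonempty_iff]
    intro h
    apply hx
    rw [← hsum x, h, map_zero]
  set n := (δ x).coeff.support.max' hne with hn
  have hnmem := Finset.max'_mem _ hne
  rw [← hn, Finsupp.mem_support_iff] at hnmem
  have htop : ∀ k, n < k → (δ x).coeff k = 0 := by
    intro k hk
    by_contra h
    exact absurd (Finset.le_max' _ k (Finsupp.mem_support_iff.2 h)) (not_le.2 hk)
  apply hnmem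
  refine hom_all G R (hco x n) ?_
  refine hom_ind G R ?_ ?_
  · intro m y hy
    have hyc : ∀ k, m < k → (δ y).coeff k = 0 := by
      intro k hk
      rw [hD m y hy, AddMonoidAlgebra.coeff_single, Finsupp.single_apply, if_neg hk.ne]
    have hym : (δ y).coeff m = y := by
      rw [hD m y hy, AddMonoidAlgebra.coeff_single, Finsupp.single_apply, if_pos rfl]
    obtain ⟨h1, h2⟩ := top_mul htop hyc
    obtain ⟨h3, -⟩ := top_mul h2 htop
    rw [← map_mul, ← map_mul, Q, map_zero, map_mul, h1, hym] at h3
    rw [← h3]; rfl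
  · intro y z hy hz
    rw [mul_add, add_mul, hy, hz, add_zero]
end SemiprimeAux
end Ultragraph
open Ultragraph in
/-- `L_R(𝒢)` is semiprime when `R` has no zero divisors: every two-sided ideal whose
square is zero is zero. -/
theorem leavittAlgebra_semiprime {V : Type u} {E : Type v} (G : Ultragraph V E)
    (R : Type w) [CommRing R] [NoZeroDivisors R]
    (I : TwoSidedIdeal (LeavittAlgebra R G))
    (hI : ∀ x ∈ I, ∀ y ∈ I, x * y = 0) :
    ∀ x ∈ I, x = 0 := by
  intro x hx
  refine semiprime_main G R fun y => ?_
  exact hI _ (I.mul_mem_right x y hx) _ hx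
end

section
/- Let 𝒢 be an arbitrary ultragraph and R a nontrivial unital commutative ring. Then in L_R(𝒢) one has p_A ≠ 0 for every nonempty A ∈ 𝒢⁰, and s_e ≠ 0 and s_e* ≠ 0 for every e ∈ 𝒢¹. -/
universe u v w

namespace Ultragraph

variable {V : Type u} {E : Type v}

/-- Combinatorial data on `V × K` from which a representation is built. -/
structure ShiftData (G : Ultragraph V E) (K : Type*) where
  c : V × K → Option E
  f : E → V × K → V × K
  g : E → V × K → V × K
  c_f : ∀ e x, x.1 ∈ G.r e → c (f e x) = some e
  g_f : ∀ e x, x.1 ∈ G.r e → g e (f e x) = x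
  c_src : ∀ e x, c x = some e → x.1 = G.s e
  g_mem : ∀ e x, c x = some e → (g e x).1 ∈ G.r e
  f_g : ∀ e x, c x = some e → f e (g e x) = x
  c_ex : ∀ e x, G.s e = x.1 → ∃ e', c x = some e'

theorem prod_equiv_of_inj {α K : Type*} [Nonempty α]
    (hinf : Cardinal.aleph0 ≤ Cardinal.mk K) (i : α → K) (hi : Function.Injective i) :
    Nonempty ((α × K) ≃ K) := by
  have h : Cardinal.mk (K × K) = Cardinal.mk K := by
    rw [← Cardinal.mul_def, Cardinal.mul_eq_self hinf]
  obtain ⟨t⟩ := Cardinal.eq.1 h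
  obtain ⟨a⟩ := ‹Nonempty α›
  refine Function.Embedding.antisymm
    ⟨fun x => t (i x.1, x.2), ?_⟩ ⟨fun k => (a, k), fun x y h => (Prod.mk.inj h).2⟩
  intro x y h
  have h1 := Prod.mk.inj (t.injective h)
  exact Prod.ext (hi h1.1) h1.2

open scoped Classical in
theorem exists_shiftData (G : Ultragraph V E) :
    ∃ (K : Type max u v) (_ : Nonempty K), Nonempty (ShiftData G K) := by
  let K : Type max u v := (V ⊕ E) ⊕ ℕ
  have hinf : Cardinal.aleph0 ≤ Cardinal.mk K := Cardinal.aleph0_le_mk K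
  have hφ : ∀ e : E, Nonempty ((G.r e × K) ≃ K) := by
    intro e
    have := (G.r_nonempty e).to_subtype
    exact prod_equiv_of_inj hinf (fun x : G.r e => (Sum.inl (Sum.inl x.1) : K))
      (by intro a b h; exact Subtype.ext (Sum.inl_injective (Sum.inl_injective h)))
  have hψ : ∀ v : V, Nonempty {e // G.s e = v} → Nonempty (K ≃ ({e // G.s e = v} × K)) := by
    intro v hv
    obtain ⟨h⟩ := prod_equiv_of_inj hinf
      (fun x : {e // G.s e = v} => (Sum.inl (Sum.inr x.1) : K))
      (by intro a b h; exact Subtype.ext (Sum.inr_injective (Sum.inl_injective h)))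
    exact ⟨h.symm⟩
  have φ : ∀ e : E, (G.r e × K) ≃ K := fun e => (hφ e).some
  have ψ : ∀ v : V, Nonempty {e // G.s e = v} → (K ≃ ({e // G.s e = v} × K)) :=
    fun v hv => (hψ v hv).some
  refine ⟨K, ⟨Sum.inr 0⟩, ⟨{
    c := fun x => if h : Nonempty {e // G.s e = x.1} then some (ψ x.1 h x.2).1.1 else none
    f := fun e x => if h : x.1 ∈ G.r e then
      (G.s e, (ψ (G.s e) ⟨⟨e, rfl⟩⟩).symm (⟨e, rfl⟩, φ e (⟨x.1, h⟩, x.2))) else x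
    g := fun e x => (((φ e).symm (ψ (G.s e) ⟨⟨e, rfl⟩⟩ x.2).2).1.1,
      ((φ e).symm (ψ (G.s e) ⟨⟨e, rfl⟩⟩ x.2).2).2)
    c_f := ?_, g_f := ?_, c_src := ?_, g_mem := ?_, f_g := ?_, c_ex := ?_ }⟩⟩
  · intro e x h
    have hn : Nonempty {f // G.s f = G.s e} := ⟨⟨e, rfl⟩⟩
    rw [dif_pos h, dif_pos hn]
    simp
  · intro e x h
    simp [h]
  · intro e x h
    split_ifs at h with hn
    simp only [Option.some.injEq] at h
    rw [← h]
    exact (ψ x.1 hn x.2).1.2.symm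
  · intro e x h
    exact ((φ e).symm (ψ (G.s e) ⟨⟨e, rfl⟩⟩ x.2).2).1.2
  · rintro e ⟨v, k⟩ h
    simp only at h
    split_ifs at h with hn
    simp only [Option.some.injEq] at h
    have hv : G.s e = v := by rw [← h]; exact (ψ v hn k).1.2
    subst hv
    have h2 : (ψ (G.s e) hn k).1 = ⟨e, rfl⟩ := Subtype.ext h
    simp only [Subtype.coe_prop, dite_true, Prod.mk.eta, Equiv.apply_symm_apply, Subtype.coe_eta]
    rw [← h2]
    simp
  · intro e x h
    have hn : Nonempty {f // G.s f = x.1} := ⟨⟨e, h⟩⟩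
    exact ⟨_, dif_pos hn⟩

section rep
variable {G : Ultragraph V E} {K : Type*} (B : ShiftData G K) (R : Type w) [CommRing R]

open scoped Classical in
/-- Images of the generators. -/
noncomputable def genMap : LGen G → Module.End R (V × K → R)
  | .edge e =>
    { toFun := fun φ x => if B.c x = some e then φ (B.g e x) else 0
      map_add' := by intro a b; ext x; by_cases h : B.c x = some e <;> simp [h]
      map_smul' := by intro a b; ext x; by_cases h : B.c x = some e <;> simp [h] }
  | .ghost e =>
    { toFun := fun φ x => if x.1 ∈ G.r e then φ (B.f e x) else 0
      map_add' := by intro a b; ext x; by_cases h : x.1 ∈ G.r e <;> simp [h]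
      map_smul' := by intro a b; ext x; by_cases h : x.1 ∈ G.r e <;> simp [h] }
  | .proj A =>
    { toFun := fun φ x => if x.1 ∈ A.1 then φ x else 0
      map_add' := by intro a b; ext x; by_cases h : x.1 ∈ A.1 <;> simp [h]
      map_smul' := by intro a b; ext x; by_cases h : x.1 ∈ A.1 <;> simp [h] }

open scoped Classical in
theorem genMap_edge (e : E) (φ : V × K → R) (x : V × K) :
    genMap B R (.edge e) φ x = if B.c x = some e then φ (B.g e x) else 0 := rfl

open scoped Classical in
theorem genMap_ghost (e : E) (φ : V × K → R) (x : V × K) :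
    genMap B R (.ghost e) φ x = if x.1 ∈ G.r e then φ (B.f e x) else 0 := rfl

open scoped Classical in
theorem genMap_proj (A : G.G0) (φ : V × K → R) (x : V × K) :
    genMap B R (.proj A) φ x = if x.1 ∈ A.1 then φ x else 0 := rfl

theorem emptyG0_val (G : Ultragraph V E) : G.emptyG0.1 = ∅ := rfl
theorem interG0_val (G : Ultragraph V E) (A B : G.G0) : (G.interG0 A B).1 = A.1 ∩ B.1 := rfl
theorem unionG0_val (G : Ultragraph V E) (A B : G.G0) : (G.unionG0 A B).1 = A.1 ∪ B.1 := rfl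
theorem vtx_val (G : Ultragraph V E) (v : V) : (G.vtx v).1 = {v} := rfl
theorem rng_val (G : Ultragraph V E) (e : E) : (G.rng e).1 = G.r e := rfl

theorem genMap_rel (a b : FreeAlgebra R (LGen G)) (h : LeavittRel R G a b) :
    FreeAlgebra.lift R (genMap B R) a = FreeAlgebra.lift R (genMap B R) b := by
  classical
  induction h with
  | p_empty =>
    refine LinearMap.ext fun φ => funext fun x => ?_
    simp [genMap_proj, emptyG0_val]
  | p_mul A C =>
    refine LinearMap.ext fun φ => funext fun x => ?_
    by_cases h1 : x.1 ∈ A.1 <;> by_cases h2 : x.1 ∈ C.1 <;>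
      simp [genMap_proj, interG0_val, h1, h2]
  | p_union A C =>
    refine LinearMap.ext fun φ => funext fun x => ?_
    by_cases h1 : x.1 ∈ A.1 <;> by_cases h2 : x.1 ∈ C.1 <;>
      simp [genMap_proj, interG0_val, unionG0_val, h1, h2]
  | src_edge e =>
    refine LinearMap.ext fun φ => funext fun x => ?_
    by_cases h : B.c x = some e
    · have := B.c_src e x h
      simp [genMap_proj, genMap_edge, vtx_val, this, h]
    · simp [genMap_proj, genMap_edge, h]
  | edge_rng e =>
    refine LinearMap.ext fun φ => funext fun x => ?_
    by_cases h : B.c x = some e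
    · have := B.g_mem e x h
      simp [genMap_proj, genMap_edge, rng_val, this, h]
    · simp [genMap_edge, h]
  | rng_ghost e =>
    refine LinearMap.ext fun φ => funext fun x => ?_
    by_cases h : x.1 ∈ G.r e <;> simp [genMap_proj, genMap_ghost, rng_val, h]
  | ghost_src e =>
    refine LinearMap.ext fun φ => funext fun x => ?_
    by_cases h : x.1 ∈ G.r e
    · have := B.c_src e _ (B.c_f e x h)
      simp [genMap_proj, genMap_ghost, vtx_val, this, h]
    · simp [genMap_ghost, h]
  | @ghost_edge_ne e f hne =>
    refine LinearMap.ext fun φ => funext fun x => ?_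
    by_cases h : x.1 ∈ G.r e
    · simp [genMap_edge, genMap_ghost, B.c_f e x h, hne]
    · simp [genMap_ghost, h]
  | ghost_edge e =>
    refine LinearMap.ext fun φ => funext fun x => ?_
    by_cases h : x.1 ∈ G.r e
    · simp [genMap_edge, genMap_ghost, genMap_proj, rng_val, h, B.c_f e x h, B.g_f e x h]
    · simp [genMap_ghost, genMap_proj, rng_val, h]
  | ck v hfin hne =>
    refine LinearMap.ext fun φ => funext fun x => ?_
    have key : ∀ e, genMap B R (.edge e) (genMap B R (.ghost e) φ) x =
        if B.c x = some e then φ x else 0 := by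
      intro e
      by_cases h : B.c x = some e
      · simp [genMap_edge, genMap_ghost, h, B.g_mem e x h, B.f_g e x h]
      · simp [genMap_edge, h]
    simp only [map_sum, map_mul, FreeAlgebra.lift_ι_apply, LinearMap.sum_apply, Finset.sum_apply,
      Module.End.mul_apply, key, genMap_proj]
    by_cases hx : x.1 = v
    · obtain ⟨e0, he0⟩ := hne
      obtain ⟨e, he⟩ := B.c_ex e0 x (he0.trans hx.symm)
      have hs : e ∈ hfin.toFinset := by
        simpa using (B.c_src e x he).symm.trans hx
      simp only [he, Option.some.injEq, Finset.sum_ite_eq, hs, if_true]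
      simp [vtx_val, hx]
    · rw [Finset.sum_eq_zero]
      · simp [vtx_val, hx]
      · intro e hs
        rw [if_neg]
        intro he
        have : G.s e = v := by simpa using hs
        exact hx ((B.c_src e x he).trans this)

end rep

theorem Pg_ne_zero (G : Ultragraph V E) (R : Type w) [CommRing R] [Nontrivial R]
    (A : G.G0) (hA : A.1.Nonempty) : G.Pg R A ≠ 0 := by
  classical
  obtain ⟨K, ⟨k⟩, ⟨B⟩⟩ := exists_shiftData G
  obtain ⟨v, hv⟩ := hA
  intro h
  have h1 := congrArg (RingQuot.liftAlgHom R
    ⟨FreeAlgebra.lift R (genMap B R), fun {a b} => genMap_rel B R a b⟩) h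
  unfold Pg at h1
  erw [RingQuot.liftAlgHom_mkAlgHom_apply, map_zero] at h1
  rw [FreeAlgebra.lift_ι_apply] at h1
  have h2 := congrFun (LinearMap.congr_fun h1 (fun _ => 1)) (v, k)
  rw [genMap_proj, if_pos hv] at h2
  exact one_ne_zero h2

theorem St_mul_Se (G : Ultragraph V E) (R : Type w) [CommRing R] (e : E) :
    G.St R e * G.Se R e = G.Pg R (G.rng e) := by
  have := RingQuot.mkAlgHom_rel R (LeavittRel.ghost_edge (R := R) (G := G) e)
  rw [map_mul] at this
  exact this

end Ultragraph

open Ultragraph in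
/-- Over a nontrivial commutative ring, `p_A ≠ 0` for nonempty `A ∈ 𝒢⁰`, and
`s_e ≠ 0 ≠ s_e*` for every edge `e`. -/
theorem generators_ne_zero {V : Type u} {E : Type v} (G : Ultragraph V E)
    (R : Type w) [CommRing R] [Nontrivial R] :
    (∀ A : G.G0, A.1.Nonempty → G.Pg R A ≠ 0) ∧
    (∀ e : E, G.Se R e ≠ 0) ∧ (∀ e : E, G.St R e ≠ 0) := by
  refine ⟨fun A hA => Pg_ne_zero G R A hA, fun e h => ?_, fun e h => ?_⟩
  · apply Pg_ne_zero G R (G.rng e) (G.r_nonempty e)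
    rw [← St_mul_Se, h, mul_zero]
  · apply Pg_ne_zero G R (G.rng e) (G.r_nonempty e)
    rw [← St_mul_Se, h, zero_mul]
end

section
/- Let 𝒢 be an ultragraph such that s⁻¹(v) is finite or countable for each vertex v ∈ G⁰ and r(e) is finite or countable for each edge e ∈ 𝒢¹. Then there exists a set X and a 𝒢-algebraic branching system {R_e, D_A, f_e}_{e∈𝒢¹, A∈𝒢⁰} on X. -/
universe u v w

/-- Edges can be distributed over `V × ℕ` so that each edge is used infinitely often, exactly
at its source. -/
theorem Ultragraph.exists_coloring {V : Type u} {E : Type v} (G : Ultragraph V E)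
    (h1 : ∀ v : V, {e : E | G.s e = v}.Countable) (v : V) :
    ∃ c : ℕ → Option E, (∀ e, G.s e = v → {n | c n = some e}.Infinite) ∧
      (∀ n e, c n = some e → G.s e = v) ∧
      ({e : E | G.s e = v}.Nonempty → ∀ n, ∃ e, c n = some e) := by
  by_cases hne : {e : E | G.s e = v}.Nonempty
  · obtain ⟨g, hg⟩ := (h1 v).exists_eq_range hne
    refine ⟨fun n => some (g n.unpair.1), ?_, ?_, fun _ n => ⟨_, rfl⟩⟩
    · intro e he
      have hm : e ∈ Set.range g := hg ▸ he
      obtain ⟨k, hk⟩ := hm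
      refine Set.infinite_of_injective_forall_mem (f := fun m : ℕ => Nat.pair k m) ?_ ?_
      · intro a b hab
        exact (Nat.pair_eq_pair.1 hab).2
      · intro m
        simp [hk]
    · intro n e h
      have hm : g n.unpair.1 ∈ {e : E | G.s e = v} := hg ▸ Set.mem_range_self _
      rw [← Option.some.inj h]
      exact hm
  · refine ⟨fun _ => none, fun e he => (hne ⟨e, he⟩).elim, fun n e h => by simp at h,
      fun h => (hne h).elim⟩

/-- The nondegenerate form of the existence theorem: all the sets `D_v` are infinite. -/
theorem Ultragraph.exists_branchingSystem_infinite {V : Type u} {E : Type v}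
    (G : Ultragraph V E)
    (h1 : ∀ v : V, {e : E | G.s e = v}.Countable)
    (h2 : ∀ e : E, (G.r e).Countable) :
    ∃ (X : Type (max u v)) (B : G.BranchingSystem X), ∀ v, (B.D (G.vtx v)).Infinite := by
  choose c hinf hsrc hall using G.exists_coloring h1
  let X : Type (max u v) := ULift.{v} (V × ℕ)
  let D : G.G0 → Set X := fun A => {x | x.down.1 ∈ A.1}
  let Re : E → Set X := fun e => {x | c x.down.1 x.down.2 = some e}
  have hDinf : ∀ (A : G.G0) (v : V), v ∈ A.1 → (D A).Infinite := by
    intro A v hv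
    refine Set.infinite_of_injective_forall_mem
      (f := fun n : ℕ => (ULift.up (v, n) : X)) ?_ (fun n => hv)
    intro a b hab
    exact congrArg (fun x : X => x.down.2) hab
  have hDc : ∀ A : G.G0, A.1.Countable → (D A).Countable := by
    intro A hA
    have hp : (A.1 ×ˢ (Set.univ : Set ℕ)).Countable := hA.prod Set.countable_univ
    have hq : ((ULift.down : X → V × ℕ) ⁻¹' (A.1 ×ˢ (Set.univ : Set ℕ))).Countable :=
      hp.preimage ULift.down_injective
    refine hq.mono ?_
    intro x hx
    exact ⟨hx, trivial⟩
  have hReD : ∀ e, Re e ⊆ D (G.vtx (G.s e)) := fun e x hx => (hsrc _ _ _ hx).symm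
  have hReinf : ∀ e, (Re e).Infinite := by
    intro e
    have hi := (hinf (G.s e) e rfl).image
      (f := fun n : ℕ => (ULift.up (G.s e, n) : X))
      (fun a _ b _ hab => congrArg (fun x : X => x.down.2) hab)
    refine hi.mono ?_
    rintro _ ⟨n, hn, rfl⟩
    exact hn
  have hf : ∀ e, Nonempty (↥(D (G.rng e)) ≃ ↥(Re e)) := by
    intro e
    have : Countable (D (G.rng e)) := (hDc _ (h2 e)).to_subtype
    have : Countable (Re e) :=
      ((hDc _ (Set.countable_singleton _)).mono (hReD e)).to_subtype
    obtain ⟨w, hw⟩ := G.r_nonempty e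
    have : Infinite (D (G.rng e)) := (hDinf _ w hw).to_subtype
    have : Infinite (Re e) := (hReinf e).to_subtype
    exact nonempty_equiv_of_countable
  refine ⟨X, {
    Re := Re
    D := D
    disj := ?_
    D_empty := rfl
    D_inter := fun A B => rfl
    D_union := fun A B => rfl
    Re_subset := hReD
    D_vtx := ?_
    fe := fun e => (hf e).some }, fun v => hDinf _ v rfl⟩
  · intro e f hef
    ext x
    refine ⟨fun hx => hef ?_, fun hx => hx.elim⟩
    exact Option.some.inj (hx.1.symm.trans hx.2)
  · intro v _ hne
    ext x
    simp only [Set.mem_iUnion]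
    constructor
    · intro hx
      have hx' : x.down.1 = v := hx
      obtain ⟨e, he⟩ := hall v hne x.down.2
      exact ⟨e, hsrc _ _ _ he, by rw [← hx'] at he; exact he⟩
    · rintro ⟨e, he, hx⟩
      exact (hsrc _ _ _ hx).symm.trans he

open Ultragraph in
/-- If `s⁻¹(v)` and `r(e)` are finite or countable for every vertex `v` and edge `e`,
then there exists a `𝒢`-algebraic branching system. -/
theorem exists_branchingSystem {V : Type u} {E : Type v} (G : Ultragraph V E)
    (h1 : ∀ v : V, {e : E | G.s e = v}.Countable)
    (h2 : ∀ e : E, (G.r e).Countable) :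
    ∃ X : Type (max u v), Nonempty (G.BranchingSystem X) := by
  obtain ⟨X, B, _⟩ := G.exists_branchingSystem_infinite h1 h2
  exact ⟨X, ⟨B⟩⟩
end

section
/- Let 𝒢 be an ultragraph, R a unital commutative ring, and {R_e, D_A, f_e}_{e∈𝒢¹, A∈𝒢⁰} a 𝒢-algebraic branching system on a set X. Let M be the R-module of all functions from X to R. Then there exists a unique R-algebra homomorphism π : L_R(𝒢) → Hom_R(M) such that for each e ∈ 𝒢¹, A ∈ 𝒢⁰ and φ ∈ M: π(s_e)(φ) = (φ ∘ f_e⁻¹)·1_{R_e}, π(s_e*)(φ) = (φ ∘ f_e)·1_{D_{r(e)}}, and π(p_A)(φ) = 1_{D_A}·φ. -/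
universe u v w

namespace Ultragraph

open scoped Classical

variable {V : Type u} {E : Type v} {G : Ultragraph V E} {X : Type*}

/-- The operator for `s_e`. -/
noncomputable def opS (R : Type w) [CommRing R] (B : BranchingSystem G X) (e : E) :
    Module.End R (X → R) where
  toFun φ := fun x => if h : x ∈ B.Re e then φ ((B.fe e).symm ⟨x, h⟩ : X) else 0
  map_add' φ ψ := by
    funext x
    by_cases h : x ∈ B.Re e <;> simp [h]
  map_smul' c φ := by
    funext x
    by_cases h : x ∈ B.Re e <;> simp [h]

/-- The operator for `s_e*`. -/
noncomputable def opT (R : Type w) [CommRing R] (B : BranchingSystem G X) (e : E) :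
    Module.End R (X → R) where
  toFun φ := fun x => if h : x ∈ B.D (G.rng e) then φ ((B.fe e ⟨x, h⟩ : X)) else 0
  map_add' φ ψ := by
    funext x
    by_cases h : x ∈ B.D (G.rng e) <;> simp [h]
  map_smul' c φ := by
    funext x
    by_cases h : x ∈ B.D (G.rng e) <;> simp [h]

/-- The operator for `p_A`. -/
noncomputable def opP (R : Type w) [CommRing R] (B : BranchingSystem G X) (A : G.G0) :
    Module.End R (X → R) where
  toFun φ := fun x => if x ∈ B.D A then φ x else 0
  map_add' φ ψ := by
    funext x
    by_cases h : x ∈ B.D A <;> simp [h]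
  map_smul' c φ := by
    funext x
    by_cases h : x ∈ B.D A <;> simp [h]

theorem opS_apply (R : Type w) [CommRing R] (B : BranchingSystem G X) (e : E) (φ : X → R) (x : X) :
    opS R B e φ x = if h : x ∈ B.Re e then φ ((B.fe e).symm ⟨x, h⟩ : X) else 0 := rfl

theorem opT_apply (R : Type w) [CommRing R] (B : BranchingSystem G X) (e : E) (φ : X → R) (x : X) :
    opT R B e φ x = if h : x ∈ B.D (G.rng e) then φ ((B.fe e ⟨x, h⟩ : X)) else 0 := rfl

theorem opP_apply (R : Type w) [CommRing R] (B : BranchingSystem G X) (A : G.G0)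
    (φ : X → R) (x : X) :
    opP R B A φ x = if x ∈ B.D A then φ x else 0 := rfl

/-- The operator attached to a generator. -/
noncomputable def opGen (R : Type w) [CommRing R] (B : BranchingSystem G X) :
    LGen G → Module.End R (X → R)
  | .edge e => opS R B e
  | .ghost e => opT R B e
  | .proj A => opP R B A

theorem opST_apply (R : Type w) [CommRing R] (B : BranchingSystem G X) (e : E)
    (φ : X → R) (x : X) :
    (opS R B e * opT R B e) φ x = if x ∈ B.Re e then φ x else 0 := by
  rw [Module.End.mul_apply, opS_apply]
  by_cases h : x ∈ B.Re e
  · simp [h, opT_apply]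
  · simp [h]

theorem opGen_rel (R : Type w) [CommRing R] (B : BranchingSystem G X)
    {a b : FreeAlgebra R (LGen G)} (h : LeavittRel R G a b) :
    FreeAlgebra.lift R (opGen R B) a = FreeAlgebra.lift R (opGen R B) b := by
  induction h with
  | p_empty =>
    refine LinearMap.ext fun φ => funext fun x => ?_
    simp [opGen, opP_apply, B.D_empty]
  | p_mul A C =>
    refine LinearMap.ext fun φ => funext fun x => ?_
    simp only [map_mul, FreeAlgebra.lift_ι_apply, opGen, Module.End.mul_apply, opP_apply,
      ← B.D_inter, Set.mem_inter_iff, ite_and]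
  | p_union A C =>
    refine LinearMap.ext fun φ => funext fun x => ?_
    simp only [map_add, map_sub, FreeAlgebra.lift_ι_apply, opGen, LinearMap.add_apply,
      LinearMap.sub_apply, Pi.add_apply, Pi.sub_apply, opP_apply,
      ← B.D_inter, ← B.D_union, Set.mem_inter_iff, Set.mem_union]
    by_cases h1 : x ∈ B.D A <;> by_cases h2 : x ∈ B.D C <;> simp [h1, h2]
  | src_edge e =>
    refine LinearMap.ext fun φ => funext fun x => ?_
    simp only [map_mul, FreeAlgebra.lift_ι_apply, opGen, Module.End.mul_apply, opP_apply,
      opS_apply]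
    by_cases h : x ∈ B.Re e
    · simp [h, B.Re_subset e h]
    · simp [h]
  | edge_rng e =>
    refine LinearMap.ext fun φ => funext fun x => ?_
    simp only [map_mul, FreeAlgebra.lift_ι_apply, opGen, Module.End.mul_apply, opP_apply,
      opS_apply]
    by_cases h : x ∈ B.Re e <;> simp [h]
  | rng_ghost e =>
    refine LinearMap.ext fun φ => funext fun x => ?_
    simp only [map_mul, FreeAlgebra.lift_ι_apply, opGen, Module.End.mul_apply, opP_apply,
      opT_apply]
    by_cases h : x ∈ B.D (G.rng e) <;> simp [h]
  | ghost_src e =>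
    refine LinearMap.ext fun φ => funext fun x => ?_
    simp only [map_mul, FreeAlgebra.lift_ι_apply, opGen, Module.End.mul_apply, opP_apply,
      opT_apply]
    by_cases h : x ∈ B.D (G.rng e)
    · simp [h, B.Re_subset e (B.fe e ⟨x, h⟩).2]
    · simp [h]
  | @ghost_edge_ne e f hne =>
    refine LinearMap.ext fun φ => funext fun x => ?_
    simp only [map_mul, map_zero, FreeAlgebra.lift_ι_apply, opGen, Module.End.mul_apply,
      opS_apply, opT_apply, LinearMap.zero_apply, Pi.zero_apply]
    by_cases h : x ∈ B.D (G.rng e)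
    · have h2 : (B.fe e ⟨x, h⟩ : X) ∉ B.Re f := fun h3 => by
        have h4 : (B.fe e ⟨x, h⟩ : X) ∈ B.Re e ∩ B.Re f := ⟨(B.fe e ⟨x, h⟩).2, h3⟩
        rw [B.disj hne] at h4
        exact h4
      simp [h, h2]
    · simp [h]
  | ghost_edge e =>
    refine LinearMap.ext fun φ => funext fun x => ?_
    simp only [map_mul, FreeAlgebra.lift_ι_apply, opGen, Module.End.mul_apply,
      opS_apply, opT_apply, opP_apply]
    by_cases h : x ∈ B.D (G.rng e) <;> simp [h]
  | ck v hfin hne =>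
    refine LinearMap.ext fun φ => funext fun x => ?_
    simp only [map_mul, map_sum, FreeAlgebra.lift_ι_apply, opGen, LinearMap.sum_apply,
      Finset.sum_apply, opST_apply, opP_apply]
    rw [B.D_vtx v hfin hne]
    by_cases h : ∃ e, G.s e = v ∧ x ∈ B.Re e
    · obtain ⟨e, he, hx⟩ := h
      rw [Finset.sum_eq_single e, if_pos hx, if_pos]
      · simp only [Set.mem_iUnion]
        exact ⟨e, he, hx⟩
      · intro f _ hf
        refine if_neg fun h3 => ?_
        have h4 : x ∈ B.Re f ∩ B.Re e := ⟨h3, hx⟩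
        rw [B.disj hf] at h4
        exact h4
      · intro h
        exact absurd (hfin.mem_toFinset.2 he) h
    · rw [Finset.sum_eq_zero, if_neg]
      · simp only [Set.mem_iUnion]
        rintro ⟨e, he, hx⟩
        exact h ⟨e, he, hx⟩
      · intro e he
        exact if_neg fun hx => h ⟨e, hfin.mem_toFinset.1 he, hx⟩

/-- The induced representation. -/
noncomputable def indRep (R : Type w) [CommRing R] (B : BranchingSystem G X) :
    LeavittAlgebra R G →ₐ[R] Module.End R (X → R) :=
  RingQuot.liftAlgHom R (s := LeavittRel R G)
    ⟨FreeAlgebra.lift R (opGen R B), fun _ _ h => opGen_rel R B h⟩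

theorem indRep_mk (R : Type w) [CommRing R] (B : BranchingSystem G X) (g : LGen G) :
    indRep R B (RingQuot.mkAlgHom R (LeavittRel R G) (FreeAlgebra.ι R g)) = opGen R B g := by
  refine (RingQuot.liftAlgHom_mkAlgHom_apply R _ _ _).trans ?_
  exact FreeAlgebra.lift_ι_apply _ _

theorem leavitt_hom_ext (R : Type w) [CommRing R] {S : Type*} [Ring S] [Algebra R S]
    (f g : LeavittAlgebra R G →ₐ[R] S)
    (h : ∀ a : LGen G, f (RingQuot.mkAlgHom R (LeavittRel R G) (FreeAlgebra.ι R a)) =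
      g (RingQuot.mkAlgHom R (LeavittRel R G) (FreeAlgebra.ι R a))) : f = g := by
  refine RingQuot.ringQuot_ext' R (s := LeavittRel R G) f g ?_
  refine FreeAlgebra.hom_ext (funext fun a => ?_)
  exact h a

end Ultragraph

open Ultragraph in
/-- Every `𝒢`-algebraic branching system induces a unique representation
`π : L_R(𝒢) → Hom_R(M)`, `M` the module of all functions `X → R`, with
`π(s_e)(φ) = (φ ∘ f_e⁻¹)·1_{R_e}`, `π(s_e*)(φ) = (φ ∘ f_e)·1_{D_{r(e)}}` and
`π(p_A)(φ) = 1_{D_A}·φ`. -/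
theorem existsUnique_induced_representation {V : Type u} {E : Type v}
    (G : Ultragraph V E) (R : Type w) [CommRing R]
    {X : Type*} (B : G.BranchingSystem X) :
    ∃! π : LeavittAlgebra R G →ₐ[R] Module.End R (X → R), IsInducedRep G R B π := by
  refine ⟨indRep R B, ⟨fun e φ x => ?_, fun e φ x => ?_, fun A φ x => ?_⟩, ?_⟩
  · exact congrFun (congrArg (fun T : Module.End R (X → R) => T φ) (indRep_mk R B (.edge e))) x
  · exact congrFun (congrArg (fun T : Module.End R (X → R) => T φ) (indRep_mk R B (.ghost e))) x
  · exact congrFun (congrArg (fun T : Module.End R (X → R) => T φ) (indRep_mk R B (.proj A))) x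
  · rintro π ⟨h1, h2, h3⟩
    refine leavitt_hom_ext R π (indRep R B) fun a => ?_
    rw [indRep_mk]
    refine LinearMap.ext fun φ => funext fun x => ?_
    cases a with
    | edge e => exact h1 e φ x
    | ghost e => exact h2 e φ x
    | proj A => exact h3 A φ x
end
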